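/- arXiv:2009.13710 — 2 statements merged into one kernel-verified Lean document; each statement's English description precedes it below -/
import Mathlib

section
/- Let ℓ ≥ 2 and m ≥ 1 be integers. The ℓ + 1 vectors ζ̃_0^m, ζ̃_1^m, …, ζ̃_{ℓ−2}^m, θ_0, θ_E form a basis of the ℂ[x_1,…,x_ℓ,z]-module D(cCat_ℓ(m)); that is, they are linearly independent over ℂ[x_1,…,x_ℓ,z] and generate D(cCat_ℓ(m)). -/
open MvPolynomial Polynomial

noncomputable section

abbrev S (ℓ : ℕ) := MvPolynomial (Fin ℓ) ℂ

/-- R = ℂ[x_1, …, x_ℓ, z]; the variable indexed by `Fin.last ℓ` is z. -/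
abbrev R (ℓ : ℕ) := MvPolynomial (Fin (ℓ + 1)) ℂ

def gpoly (ℓ : ℕ) : Polynomial (S ℓ) :=
  ∏ p : Fin ℓ, (Polynomial.X - Polynomial.C (MvPolynomial.X p))

/-- Falling power f(t)^{\underline{m}} = f(t) f(t-1) ⋯ f(t-m+1). -/
def fpow {A : Type*} [CommRing A] (f : Polynomial A) (m : ℕ) : Polynomial A :=
  ∏ i ∈ Finset.range m, f.comp (Polynomial.X - (i : Polynomial A))

/-- Homogenization z^d f(x_1/z, …, x_ℓ/z) of a polynomial of degree ≤ d. -/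
def homog (ℓ d : ℕ) (f : S ℓ) : R ℓ :=
  f.support.sum fun e => MvPolynomial.monomial
    (Finsupp.mapDomain Fin.castSucc e +
      Finsupp.single (Fin.last ℓ) (d - e.sum fun _ n => n))
    (MvPolynomial.coeff e f)

/-- Homogenization of a polynomial vector field δ = ∑ f_i ∂_i, using
d = max_i deg f_i; the ∂_z-component is 0. -/
def vfHomog (ℓ : ℕ) (δ : Fin ℓ → S ℓ) : Fin (ℓ + 1) → R ℓ := fun i =>
  if h : (i : ℕ) < ℓ then
    homog ℓ (Finset.univ.sup fun a => (δ a).totalDegree) (δ ⟨i, h⟩)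
  else 0

/-- The vector field ζ_k^m built from an antidifference F of t^k g(t)^{\underline{m}}:
its i-th coefficient is ∑_j Σ_{x_i}^{x_j} t^k g(t)^{\underline{m}} Δt = ∑_j (F(x_j) - F(x_i)). -/
def zetaVF (ℓ : ℕ) (F : Polynomial (S ℓ)) : Fin ℓ → S ℓ := fun i =>
  ∑ j : Fin ℓ, (F.eval (MvPolynomial.X j) - F.eval (MvPolynomial.X i))

/-- θ_0 = ∂_1 + ⋯ + ∂_ℓ as a vector field on ℂ^{ℓ+1}. -/
def theta0c (ℓ : ℕ) : Fin (ℓ + 1) → R ℓ := fun i => if (i : ℕ) < ℓ then 1 else 0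

/-- The Euler vector field θ_E = z ∂_z + x_1 ∂_1 + ⋯ + x_ℓ ∂_ℓ. -/
def thetaE (ℓ : ℕ) : Fin (ℓ + 1) → R ℓ := fun i => MvPolynomial.X i

/-- D(cCat_ℓ(m)). -/
def DcCat (ℓ m : ℕ) : Submodule (R ℓ) (Fin (ℓ + 1) → R ℓ) where
  carrier := {f | MvPolynomial.X (Fin.last ℓ) ∣ f (Fin.last ℓ) ∧
    ∀ i j : Fin ℓ, i < j → ∀ p : ℤ, -(m : ℤ) ≤ p → p ≤ m →
      (MvPolynomial.X i.castSucc - MvPolynomial.X j.castSucc -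
          (p : R ℓ) * MvPolynomial.X (Fin.last ℓ)) ∣
        (f i.castSucc - f j.castSucc - (p : R ℓ) * f (Fin.last ℓ))}
  zero_mem' := by
    refine ⟨by simp, ?_⟩
    intro i j _ p _ _
    simp
  add_mem' := by
    intro f g hf hg
    refine ⟨?_, ?_⟩
    · have := hf.1.add hg.1
      simpa using this
    · intro i j hij p hp1 hp2
      have h := (hf.2 i j hij p hp1 hp2).add (hg.2 i j hij p hp1 hp2)
      have e : (f i.castSucc - f j.castSucc - (p : R ℓ) * f (Fin.last ℓ)) +
          (g i.castSucc - g j.castSucc - (p : R ℓ) * g (Fin.last ℓ)) =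
          (f + g) i.castSucc - (f + g) j.castSucc - (p : R ℓ) * (f + g) (Fin.last ℓ) := by
        simp only [Pi.add_apply]; ring
      rwa [e] at h
  smul_mem' := by
    intro c f hf
    refine ⟨?_, ?_⟩
    · have := hf.1.mul_left c
      simpa using this
    · intro i j hij p hp1 hp2
      have h := (hf.2 i j hij p hp1 hp2).mul_left c
      have e : c * (f i.castSucc - f j.castSucc - (p : R ℓ) * f (Fin.last ℓ)) =
          (c • f) i.castSucc - (c • f) j.castSucc - (p : R ℓ) * (c • f) (Fin.last ℓ) := by
        simp only [Pi.smul_apply, smul_eq_mul]; ring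
      rwa [e] at h

/-- The family ζ̃_0^m, …, ζ̃_{ℓ-2}^m, θ_0, θ_E (θ_0 at index ℓ-1, θ_E at the last index). -/
def catBasis (ℓ : ℕ) (F : ℕ → Polynomial (S ℓ)) : Fin (ℓ + 1) → (Fin (ℓ + 1) → R ℓ) :=
  fun a =>
    if (a : ℕ) < ℓ - 1 then vfHomog ℓ (zetaVF ℓ (F (a : ℕ)))
    else if (a : ℕ) = ℓ - 1 then theta0c ℓ
    else thetaE ℓ

/-! ### Homogenization -/

lemma homog_eq_sum (ℓ d : ℕ) (f : S ℓ) {T : Finset (Fin ℓ →₀ ℕ)} (hT : f.support ⊆ T) :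
    homog ℓ d f = ∑ e ∈ T, MvPolynomial.monomial
      (Finsupp.mapDomain Fin.castSucc e +
        Finsupp.single (Fin.last ℓ) (d - e.sum fun _ n => n)) (MvPolynomial.coeff e f) := by
  refine Finset.sum_subset hT fun e _ he => ?_
  rw [MvPolynomial.notMem_support_iff.mp he, MvPolynomial.monomial_zero]

/-- `homog` as a linear map. -/
def homogLin (ℓ d : ℕ) : S ℓ →ₗ[ℂ] R ℓ where
  toFun := homog ℓ d
  map_add' f g := by
    classical
    rw [homog_eq_sum ℓ d (f + g) MvPolynomial.support_add,
      homog_eq_sum ℓ d f Finset.subset_union_left, homog_eq_sum ℓ d g Finset.subset_union_right,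
      ← Finset.sum_add_distrib]
    simp
  map_smul' c f := by
    rw [homog_eq_sum ℓ d (c • f) MvPolynomial.support_smul, homog_eq_sum ℓ d f subset_rfl,
      Finset.smul_sum]
    simp [MvPolynomial.smul_monomial]

lemma homogLin_apply (ℓ d : ℕ) (f : S ℓ) : homogLin ℓ d f = homog ℓ d f := rfl

lemma homog_sub (ℓ d : ℕ) (f g : S ℓ) : homog ℓ d (f - g) = homog ℓ d f - homog ℓ d g :=
  map_sub (homogLin ℓ d) f g

lemma homog_monomial (ℓ d : ℕ) (e : Fin ℓ →₀ ℕ) (c : ℂ) :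
    homog ℓ d (MvPolynomial.monomial e c) = MvPolynomial.monomial
      (Finsupp.mapDomain Fin.castSucc e +
        Finsupp.single (Fin.last ℓ) (d - e.sum fun _ n => n)) c := by
  classical
  rw [homog_eq_sum ℓ d _ MvPolynomial.support_monomial_subset]
  simp

lemma homog_mul (ℓ d d' : ℕ) (f g : S ℓ) (hf : f.totalDegree ≤ d) (hg : g.totalDegree ≤ d') :
    homog ℓ (d + d') (f * g) = homog ℓ d f * homog ℓ d' g := by
  have hfg : f * g = ∑ u ∈ f.support, ∑ v ∈ g.support,
      MvPolynomial.monomial (u + v) (f.coeff u * g.coeff v) := by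
    conv_lhs => rw [f.as_sum, g.as_sum, Finset.sum_mul_sum]
    simp [MvPolynomial.monomial_mul]
  rw [hfg, ← homogLin_apply, map_sum]
  rw [homog_eq_sum ℓ d f subset_rfl, homog_eq_sum ℓ d' g subset_rfl, Finset.sum_mul_sum]
  refine Finset.sum_congr rfl fun u hu => ?_
  rw [map_sum]
  refine Finset.sum_congr rfl fun v hv => ?_
  have hu' := (MvPolynomial.le_totalDegree hu).trans hf
  have hv' := (MvPolynomial.le_totalDegree hv).trans hg
  rw [homogLin_apply, homog_monomial, MvPolynomial.monomial_mul, Finsupp.mapDomain_add,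
    Finsupp.sum_add_index' (by simp) (by simp)]
  rw [add_add_add_comm, ← Finsupp.single_add, tsub_add_tsub_comm hu' hv']

lemma totalDegree_homog_le (ℓ d : ℕ) (f : S ℓ) (hf : f.totalDegree ≤ d) :
    (homog ℓ d f).totalDegree ≤ d := by
  refine MvPolynomial.totalDegree_finsetSum_le fun e he => ?_
  refine (MvPolynomial.totalDegree_monomial_le _ _).trans ?_
  have he' := (MvPolynomial.le_totalDegree he).trans hf
  rw [Finsupp.sum_add_index' (by simp) (by simp), Finsupp.sum_mapDomain_index (by simp) (by simp),
    Finsupp.sum_single_index rfl]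
  simp only [id]
  omega

lemma eval_homog (ℓ d : ℕ) (f : S ℓ) (x : Fin (ℓ + 1) → ℂ) (hx : x (Fin.last ℓ) = 1) :
    MvPolynomial.eval x (homog ℓ d f) = MvPolynomial.eval (fun i => x i.castSucc) f := by
  rw [homog_eq_sum ℓ d f subset_rfl, map_sum, MvPolynomial.eval_eq']
  refine Finset.sum_congr rfl fun e _ => ?_
  rw [MvPolynomial.eval_monomial, Finsupp.prod_add_index' (by simp) (by simp [pow_add]),
    Finsupp.prod_mapDomain_index (by simp) (by simp [pow_add]),
    Finsupp.prod_single_index (by simp), hx, one_pow, mul_one, Finsupp.prod_fintype _ _ (by simp)]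

lemma homog_X_sub_X_sub_int (ℓ : ℕ) (i j : Fin ℓ) (p : ℤ) :
    homog ℓ 1 (MvPolynomial.X i - MvPolynomial.X j - (p : S ℓ)) =
      MvPolynomial.X i.castSucc - MvPolynomial.X j.castSucc -
        (p : R ℓ) * MvPolynomial.X (Fin.last ℓ) := by
  have hX (i : Fin ℓ) : homog ℓ 1 (MvPolynomial.X i) = MvPolynomial.X i.castSucc := by
    rw [MvPolynomial.X, homog_monomial]
    simp [MvPolynomial.X]
  have hC : homog ℓ 1 (p : S ℓ) = (p : R ℓ) * MvPolynomial.X (Fin.last ℓ) := by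
    rw [← map_intCast (MvPolynomial.C : ℂ →+* S ℓ), ← map_intCast (MvPolynomial.C : ℂ →+* R ℓ),
      MvPolynomial.C_apply, homog_monomial, MvPolynomial.C_mul_X_eq_monomial]
    simp
  rw [homog_sub, homog_sub, hX, hX, hC]

lemma X_sub_X_sub_int_ne_zero {ℓ : ℕ} {i j : Fin ℓ} (hij : i ≠ j) (p : ℤ) :
    (MvPolynomial.X i - MvPolynomial.X j - (p : S ℓ)) ≠ 0 := by
  intro h
  have := congr(MvPolynomial.eval (Pi.single i (1 + p : ℂ)) $h)
  simp [hij.symm] at this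

lemma totalDegree_X_sub_X_sub_int {ℓ : ℕ} {i j : Fin ℓ} (hij : i ≠ j) (p : ℤ) :
    (MvPolynomial.X i - MvPolynomial.X j - (p : S ℓ)).totalDegree = 1 := by
  classical
  apply le_antisymm
  · refine (MvPolynomial.totalDegree_sub _ _).trans (max_le ?_ ?_)
    · refine (MvPolynomial.totalDegree_sub _ _).trans (by simp)
    · rw [← map_intCast (MvPolynomial.C : ℂ →+* S ℓ), MvPolynomial.totalDegree_C]; simp
  · have : Finsupp.single i 1 ∈ (MvPolynomial.X i - MvPolynomial.X j - (p : S ℓ)).support := by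
      rw [← map_intCast (MvPolynomial.C : ℂ →+* S ℓ), MvPolynomial.mem_support_iff]
      simp [-map_intCast, MvPolynomial.coeff_X, Finsupp.single_eq_zero,
        eq_comm (a := (0 : Fin ℓ →₀ ℕ)), MvPolynomial.coeff_C, Finsupp.single_left_inj, hij.symm]
    simpa using MvPolynomial.le_totalDegree this

lemma dvd_homog_sub {ℓ d : ℕ} {i j : Fin ℓ} (hij : i ≠ j) (p : ℤ) (f g : S ℓ)
    (hf : f.totalDegree ≤ d) (hg : g.totalDegree ≤ d)
    (h : (MvPolynomial.X i - MvPolynomial.X j - (p : S ℓ)) ∣ f - g) :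
    (MvPolynomial.X i.castSucc - MvPolynomial.X j.castSucc -
        (p : R ℓ) * MvPolynomial.X (Fin.last ℓ)) ∣ homog ℓ d f - homog ℓ d g := by
  obtain ⟨q, hq⟩ := h
  rw [← homog_sub]
  by_cases hq0 : q = 0
  · rw [hq, hq0, mul_zero, ← homogLin_apply, map_zero]
    exact dvd_zero _
  have hd : (f - g).totalDegree ≤ d := (MvPolynomial.totalDegree_sub _ _).trans (max_le hf hg)
  rw [hq, MvPolynomial.totalDegree_mul_of_isDomain (X_sub_X_sub_int_ne_zero hij p) hq0,
    totalDegree_X_sub_X_sub_int hij] at hd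
  rw [hq, ← Nat.add_sub_cancel' (show 1 ≤ d by omega), homog_mul _ _ _ _ _
    (totalDegree_X_sub_X_sub_int hij p).le (by omega), homog_X_sub_X_sub_int]
  exact dvd_mul_right _ _

/-! ### Finite differences -/

lemma eval_add_nat_sub_eval {A : Type*} [CommRing A] {F f : Polynomial A}
    (hF : F.comp (Polynomial.X + 1) - F = f) (a : A) (n : ℕ) :
    F.eval (a + n) - F.eval a = ∑ s ∈ Finset.range n, f.eval (a + s) := by
  have h := Finset.sum_range_sub (fun s : ℕ => F.eval (a + s)) n
  simp only [Nat.cast_zero, add_zero] at h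
  rw [← h]
  refine Finset.sum_congr rfl fun s _ => ?_
  rw [← hF]
  simp [add_assoc]

lemma eq_C_of_comp_X_add_one_eq {A : Type*} [CommRing A] [IsDomain A] [CharZero A]
    {F : Polynomial A} (hF : F.comp (Polynomial.X + 1) = F) : ∃ c, F = Polynomial.C c := by
  refine ⟨F.eval 0, Polynomial.eq_of_infinite_eval_eq _ _ ?_⟩
  refine (Set.infinite_range_of_injective (Nat.cast_injective (R := A))).mono ?_
  rintro _ ⟨n, rfl⟩
  have h := eval_add_nat_sub_eval (sub_eq_zero.mpr hF) 0 n
  simpa [sub_eq_zero] using h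

/-- An explicit antidifference, by means of Bernoulli polynomials. -/
def antidiff {A : Type*} [CommRing A] [Algebra ℚ A] (f : Polynomial A) : Polynomial A :=
  ∑ n ∈ f.support, Polynomial.C (f.coeff n) *
    (((n + 1 : ℚ)⁻¹ • Polynomial.bernoulli (n + 1)).map (algebraMap ℚ A))

lemma antidiff_comp_sub {A : Type*} [CommRing A] [Algebra ℚ A] (f : Polynomial A) :
    (antidiff f).comp (Polynomial.X + 1) - antidiff f = f := by
  conv_rhs => rw [f.as_sum_support_C_mul_X_pow]
  rw [antidiff, Polynomial.sum_comp, ← Finset.sum_sub_distrib]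
  refine Finset.sum_congr rfl fun n _ => ?_
  rw [Polynomial.mul_comp, Polynomial.C_comp, ← mul_sub]
  congr 1
  have h : ((n + 1 : ℚ)⁻¹ • Polynomial.bernoulli (n + 1)).comp (Polynomial.X + 1) -
      (n + 1 : ℚ)⁻¹ • Polynomial.bernoulli (n + 1) = Polynomial.X ^ n := by
    rw [Polynomial.smul_comp, add_comm Polynomial.X, Polynomial.bernoulli_comp_one_add_X,
      smul_add, add_sub_cancel_left, Nat.add_sub_cancel, ← Nat.cast_smul_eq_nsmul ℚ, smul_smul]
    push_cast
    rw [inv_mul_cancel₀ (by positivity), one_smul]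
  have := congr(($h).map (algebraMap ℚ A))
  simpa only [Polynomial.map_sub, Polynomial.map_comp, Polynomial.map_add, Polynomial.map_X,
    Polynomial.map_one, Polynomial.map_pow] using this

/-! ### Degree bounds -/

lemma totalDegree_eval_X_le {ℓ : ℕ} (p : Polynomial ℚ) (i : Fin ℓ) :
    ((p.map (algebraMap ℚ (S ℓ))).eval (MvPolynomial.X i)).totalDegree ≤ p.natDegree := by
  rw [Polynomial.eval_map, Polynomial.eval₂_eq_sum]
  refine MvPolynomial.totalDegree_finsetSum_le fun n hn => ?_
  beta_reduce
  rw [← Algebra.smul_def]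
  have h1 : (algebraMap ℚ ℂ (p.coeff n)) • (MvPolynomial.X i ^ n : S ℓ) =
      p.coeff n • (MvPolynomial.X i ^ n : S ℓ) := algebraMap_smul _ _ _
  rw [← h1]
  refine (MvPolynomial.totalDegree_smul_le _ _).trans ?_
  rw [MvPolynomial.totalDegree_X_pow]
  exact Polynomial.le_natDegree_of_mem_supp n hn

lemma totalDegree_antidiff_eval_le {ℓ D : ℕ} {f : Polynomial (S ℓ)}
    (hf : ∀ n, f.coeff n ≠ 0 → (f.coeff n).totalDegree + n ≤ D) (i : Fin ℓ) :
    ((antidiff f).eval (MvPolynomial.X i)).totalDegree ≤ D + 1 := by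
  rw [antidiff, Polynomial.eval_finsetSum]
  refine MvPolynomial.totalDegree_finsetSum_le fun n hn => ?_
  rw [Polynomial.eval_mul, Polynomial.eval_C]
  refine (MvPolynomial.totalDegree_mul _ _).trans ?_
  have h1 := totalDegree_eval_X_le ((n + 1 : ℚ)⁻¹ • Polynomial.bernoulli (n + 1)) i
  have h2 : ((n + 1 : ℚ)⁻¹ • Polynomial.bernoulli (n + 1)).natDegree ≤ n + 1 := by
    refine (Polynomial.natDegree_smul_le _ _).trans ?_
    rw [Polynomial.natDegree_le_iff_coeff_eq_zero]
    intro N hN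
    rw [Polynomial.coeff_bernoulli, if_neg (by omega)]
  have h3 := hf n (Polynomial.mem_support_iff.mp hn)
  omega

lemma coeff_integrand_totalDegree_le (ℓ m k n : ℕ)
    (hn : (Polynomial.X ^ k * fpow (gpoly ℓ) m).coeff n ≠ 0) :
    ((Polynomial.X ^ k * fpow (gpoly ℓ) m).coeff n).totalDegree + n ≤ k + m * ℓ := by
  set P : MvPolynomial (Fin (ℓ + 1)) ℂ := MvPolynomial.X 0 ^ k *
    ∏ a ∈ Finset.range m, ∏ p : Fin ℓ,
      (MvPolynomial.X 0 - MvPolynomial.C (a : ℂ) - MvPolynomial.X p.succ) with hP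
  have h1 : Polynomial.X ^ k * fpow (gpoly ℓ) m = MvPolynomial.finSuccEquiv ℂ ℓ P := by
    simp only [hP, fpow, gpoly, map_mul, map_prod, map_pow, map_sub,
      MvPolynomial.finSuccEquiv_X_zero, MvPolynomial.finSuccEquiv_X_succ, Polynomial.prod_comp,
      Polynomial.sub_comp, Polynomial.X_comp, Polynomial.C_comp]
    simp
  rw [h1] at hn ⊢
  refine (MvPolynomial.totalDegree_coeff_finSuccEquiv_add_le P n hn).trans ?_
  refine (MvPolynomial.totalDegree_mul _ _).trans (add_le_add ?_ ?_)
  · rw [MvPolynomial.totalDegree_X_pow]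
  · have hlin (a : ℕ) (p : Fin ℓ) : (MvPolynomial.X 0 - MvPolynomial.C (a : ℂ) -
        MvPolynomial.X p.succ : MvPolynomial (Fin (ℓ + 1)) ℂ).totalDegree ≤ 1 := by
      refine (MvPolynomial.totalDegree_sub _ _).trans (max_le ?_ (by simp))
      refine (MvPolynomial.totalDegree_sub _ _).trans (max_le (by simp) ?_)
      rw [MvPolynomial.totalDegree_C]
      exact zero_le_one
    refine (MvPolynomial.totalDegree_finsetProd _ _).trans ?_
    refine (Finset.sum_le_sum fun a _ => (MvPolynomial.totalDegree_finsetProd _ _).trans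
      (Finset.sum_le_sum fun p _ => hlin a p)).trans ?_
    simp

lemma totalDegree_zetaVF_le {ℓ m k : ℕ} {F : Polynomial (S ℓ)}
    (hF : F.comp (Polynomial.X + 1) - F = Polynomial.X ^ k * fpow (gpoly ℓ) m) (i : Fin ℓ) :
    (zetaVF ℓ F i).totalDegree ≤ k + m * ℓ + 1 := by
  set f := Polynomial.X ^ k * fpow (gpoly ℓ) m with hf
  obtain ⟨c, hc⟩ : ∃ c, F - antidiff f = Polynomial.C c := by
    apply eq_C_of_comp_X_add_one_eq
    have := antidiff_comp_sub f
    rw [Polynomial.sub_comp]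
    linear_combination hF - this
  rw [sub_eq_iff_eq_add] at hc
  refine MvPolynomial.totalDegree_finsetSum_le fun j _ => ?_
  rw [hc]
  simp only [Polynomial.eval_add, Polynomial.eval_C, add_sub_add_left_eq_sub]
  have h (i) := totalDegree_antidiff_eval_le (coeff_integrand_totalDegree_le ℓ m k) i
  exact (MvPolynomial.totalDegree_sub _ _).trans (max_le (h j) (h i))

/-! ### Membership in the module of derivations -/

lemma eval_fpow_eq_zero {A : Type*} [CommRing A] {g : Polynomial A} {a : A} (ha : g.eval a = 0)
    {m s : ℕ} (hs : s < m) : (fpow g m).eval (a + s) = 0 := by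
  rw [fpow, Polynomial.eval_prod]
  refine Finset.prod_eq_zero (Finset.mem_range.mpr hs) ?_
  simp [Polynomial.eval_comp, ha]

lemma eval_gpoly_X (ℓ : ℕ) (i : Fin ℓ) : (gpoly ℓ).eval (MvPolynomial.X i) = 0 := by
  rw [gpoly, Polynomial.eval_prod]
  exact Finset.prod_eq_zero (Finset.mem_univ i) (by simp)

lemma zetaVF_sub (ℓ : ℕ) (F : Polynomial (S ℓ)) (i j : Fin ℓ) :
    zetaVF ℓ F i - zetaVF ℓ F j =
      -(ℓ * (F.eval (MvPolynomial.X i) - F.eval (MvPolynomial.X j))) := by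
  rw [zetaVF, zetaVF, ← Finset.sum_sub_distrib]
  simp
  ring

lemma dvd_eval_sub_eval {ℓ m k : ℕ} {F : Polynomial (S ℓ)}
    (hF : F.comp (Polynomial.X + 1) - F = Polynomial.X ^ k * fpow (gpoly ℓ) m) (i j : Fin ℓ)
    {n : ℕ} (hn : n ≤ m) :
    (MvPolynomial.X i - MvPolynomial.X j - (n : S ℓ)) ∣
      F.eval (MvPolynomial.X i) - F.eval (MvPolynomial.X j) := by
  have h : F.eval (MvPolynomial.X j + (n : S ℓ)) - F.eval (MvPolynomial.X j) = 0 := by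
    rw [eval_add_nat_sub_eval hF]
    refine Finset.sum_eq_zero fun s hs => ?_
    rw [Polynomial.eval_mul, eval_fpow_eq_zero (eval_gpoly_X ℓ j)
      ((Finset.mem_range.mp hs).trans_le hn), mul_zero]
  rw [← sub_eq_zero.mp h, sub_sub]
  exact Polynomial.sub_dvd_eval_sub _ _ _

lemma dvd_zetaVF_sub {ℓ m k : ℕ} {F : Polynomial (S ℓ)}
    (hF : F.comp (Polynomial.X + 1) - F = Polynomial.X ^ k * fpow (gpoly ℓ) m) (i j : Fin ℓ)
    {p : ℤ} (hp : -(m : ℤ) ≤ p) (hp' : p ≤ m) :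
    (MvPolynomial.X i - MvPolynomial.X j - (p : S ℓ)) ∣ zetaVF ℓ F i - zetaVF ℓ F j := by
  rw [zetaVF_sub, dvd_neg]
  refine Dvd.dvd.mul_left ?_ _
  obtain ⟨n, rfl | rfl⟩ := Int.eq_nat_or_neg p
  · exact_mod_cast dvd_eval_sub_eval hF i j (n := n) (by omega)
  · rw [← neg_dvd, ← dvd_neg]
    have := dvd_eval_sub_eval hF j i (n := n) (by omega)
    convert this using 1
    · push_cast
      ring
    · ring

lemma vfHomog_castSucc (ℓ : ℕ) (δ : Fin ℓ → S ℓ) (i : Fin ℓ) :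
    vfHomog ℓ δ i.castSucc =
      homog ℓ (Finset.univ.sup fun a => (δ a).totalDegree) (δ i) := by
  simp [vfHomog]

lemma vfHomog_last (ℓ : ℕ) (δ : Fin ℓ → S ℓ) : vfHomog ℓ δ (Fin.last ℓ) = 0 := by
  simp [vfHomog]

lemma vfHomog_zetaVF_mem {ℓ m k : ℕ} {F : Polynomial (S ℓ)}
    (hF : F.comp (Polynomial.X + 1) - F = Polynomial.X ^ k * fpow (gpoly ℓ) m) :
    vfHomog ℓ (zetaVF ℓ F) ∈ DcCat ℓ m := by
  refine ⟨by simp [vfHomog_last], fun i j hij p hp hp' => ?_⟩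
  rw [vfHomog_castSucc, vfHomog_castSucc, vfHomog_last, mul_zero, sub_zero]
  have hd (i : Fin ℓ) : (zetaVF ℓ F i).totalDegree ≤
      Finset.univ.sup fun a => (zetaVF ℓ F a).totalDegree :=
    Finset.le_sup (f := fun a => (zetaVF ℓ F a).totalDegree) (Finset.mem_univ i)
  exact dvd_homog_sub hij.ne p _ _ (hd i) (hd j) (dvd_zetaVF_sub hF i j hp hp')

lemma theta0c_mem (ℓ m : ℕ) : theta0c ℓ ∈ DcCat ℓ m :=
  ⟨by simp [theta0c], fun i j _ p _ _ => by simp [theta0c]⟩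

lemma thetaE_mem (ℓ m : ℕ) : thetaE ℓ ∈ DcCat ℓ m :=
  ⟨dvd_rfl, fun _ _ _ _ _ _ => dvd_rfl⟩

lemma catBasis_mem {ℓ m : ℕ} {F : ℕ → Polynomial (S ℓ)}
    (hF : ∀ k : ℕ,
      (F k).comp (Polynomial.X + 1) - F k = Polynomial.X ^ k * fpow (gpoly ℓ) m)
    (a : Fin (ℓ + 1)) : catBasis ℓ F a ∈ DcCat ℓ m := by
  rw [catBasis]
  split_ifs
  · exact vfHomog_zetaVF_mem (hF a)
  · exact theta0c_mem ℓ m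
  · exact thetaE_mem ℓ m

/-! ### The defining polynomial -/

/-- The linear form `x_i - x_j - p z`. -/
def linForm (ℓ : ℕ) (t : Fin ℓ × Fin ℓ × ℤ) : R ℓ :=
  MvPolynomial.X t.1.castSucc - MvPolynomial.X t.2.1.castSucc -
    (t.2.2 : R ℓ) * MvPolynomial.X (Fin.last ℓ)

/-- The indices of the hyperplanes of the cone, other than the hyperplane at infinity. -/
def hyperplanes (ℓ m : ℕ) : Finset (Fin ℓ × Fin ℓ × ℤ) :=
  ((Finset.univ : Finset (Fin ℓ × Fin ℓ)).filter (fun t => t.1 < t.2) ×ˢ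
    Finset.Icc (-(m : ℤ)) m).map (Equiv.prodAssoc _ _ _).toEmbedding

lemma mem_hyperplanes {ℓ m : ℕ} {t : Fin ℓ × Fin ℓ × ℤ} :
    t ∈ hyperplanes ℓ m ↔ t.1 < t.2.1 ∧ -(m : ℤ) ≤ t.2.2 ∧ t.2.2 ≤ m := by
  obtain ⟨i, j, p⟩ := t
  simp [hyperplanes]

lemma two_mul_card_hyperplanes (ℓ m : ℕ) :
    2 * (hyperplanes ℓ m).card = ℓ * (ℓ - 1) * (2 * m + 1) := by
  have h : 2 * ((Finset.univ : Finset (Fin ℓ × Fin ℓ)).filter (fun t => t.1 < t.2)).card =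
      ℓ * (ℓ - 1) := by
    rw [Finset.card_filter, Fintype.sum_prod_type_right]
    simp only [← Finset.card_filter]
    have (j : Fin ℓ) : (Finset.univ.filter (fun i => i < j)).card = (j : ℕ) := by
      rw [Finset.filter_gt_eq_Iio, Fin.card_Iio]
    simp only [this]
    rw [Fin.sum_univ_eq_sum_range (fun i => i), mul_comm, Finset.sum_range_id_mul_two]
  rw [hyperplanes, Finset.card_map, Finset.card_product, ← mul_assoc, h, Int.card_Icc]
  congr 1
  omega

/-- The defining polynomial of the cone of the Catalan arrangement. -/
def defPoly (ℓ m : ℕ) : R ℓ :=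
  MvPolynomial.X (Fin.last ℓ) * ∏ t ∈ hyperplanes ℓ m, linForm ℓ t

lemma linForm_isHomogeneous (ℓ : ℕ) (t : Fin ℓ × Fin ℓ × ℤ) : (linForm ℓ t).IsHomogeneous 1 := by
  refine ((MvPolynomial.isHomogeneous_X _ _).sub (MvPolynomial.isHomogeneous_X _ _)).sub ?_
  rw [← map_intCast (MvPolynomial.C : ℂ →+* R ℓ)]
  exact (MvPolynomial.isHomogeneous_X _ _).C_mul _

lemma eval_linForm (ℓ : ℕ) (t : Fin ℓ × Fin ℓ × ℤ) (x : Fin (ℓ + 1) → ℂ) :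
    MvPolynomial.eval x (linForm ℓ t) = x t.1.castSucc - x t.2.1.castSucc -
      t.2.2 * x (Fin.last ℓ) := by
  simp [linForm]

lemma linForm_ne_zero {ℓ : ℕ} {t : Fin ℓ × Fin ℓ × ℤ} (ht : t.1 ≠ t.2.1) : linForm ℓ t ≠ 0 := by
  intro h
  have := congr(MvPolynomial.eval (Pi.single t.1.castSucc 1) $h)
  simp [eval_linForm, ht.symm] at this

lemma irreducible_linForm {ℓ : ℕ} {t : Fin ℓ × Fin ℓ × ℤ} (ht : t.1 ≠ t.2.1) :
    Irreducible (linForm ℓ t) := by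
  refine MvPolynomial.irreducible_of_totalDegree_eq_one
    ((linForm_isHomogeneous ℓ t).totalDegree (linForm_ne_zero ht)) fun c hc => ?_
  rw [isUnit_iff_ne_zero]
  rintro rfl
  refine linForm_ne_zero ht (MvPolynomial.ext _ _ fun e => ?_)
  rw [zero_dvd_iff.mp (hc e), MvPolynomial.coeff_zero]

lemma not_dvd_of_eval {σ : Type*} {f g : MvPolynomial σ ℂ} (x : σ → ℂ)
    (hf : MvPolynomial.eval x f = 0) (hg : MvPolynomial.eval x g ≠ 0) : ¬ f ∣ g := by
  rintro ⟨q, rfl⟩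
  simp [hf] at hg

lemma isRelPrime_linForm {ℓ : ℕ} {t u : Fin ℓ × Fin ℓ × ℤ} (ht : t.1 < t.2.1)
    (hu : u.1 < u.2.1) (htu : t ≠ u) : IsRelPrime (linForm ℓ t) (linForm ℓ u) := by
  rw [(irreducible_linForm ht.ne).isRelPrime_iff_not_dvd]
  obtain ⟨i, j, p⟩ := t
  obtain ⟨i', j', p'⟩ := u
  simp only at ht hu
  by_cases hi : i' = i ∨ i' = j
  · by_cases hj : j' = i ∨ j' = j
    · obtain ⟨rfl, rfl⟩ : i' = i ∧ j' = j := by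
        constructor <;> omega
      refine not_dvd_of_eval (Pi.single i'.castSucc (p : ℂ) + Pi.single (Fin.last ℓ) 1) ?_ ?_
      · simp [eval_linForm, hu.ne']
      · simp only [ne_eq, Prod.mk.injEq, true_and] at htu
        simpa [eval_linForm, hu.ne', sub_eq_zero] using htu
    · push Not at hj
      refine not_dvd_of_eval (Pi.single j'.castSucc 1) ?_ ?_
      · simp [eval_linForm, hj.1.symm, hj.2.symm]
      · simp [eval_linForm, hu.ne]
  · push Not at hi
    refine not_dvd_of_eval (Pi.single i'.castSucc 1) ?_ ?_
    · simp [eval_linForm, hi.1.symm, hi.2.symm]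
    · simp [eval_linForm, hu.ne']

lemma isRelPrime_linForm_X_last {ℓ : ℕ} {t : Fin ℓ × Fin ℓ × ℤ} (ht : t.1 ≠ t.2.1) :
    IsRelPrime (linForm ℓ t) (MvPolynomial.X (Fin.last ℓ)) := by
  rw [(irreducible_linForm ht).isRelPrime_iff_not_dvd]
  refine not_dvd_of_eval
    (Pi.single t.1.castSucc (t.2.2 : ℂ) + Pi.single (Fin.last ℓ) 1) ?_ ?_
  · simp [eval_linForm, ht.symm]
  · simp

lemma defPoly_ne_zero (ℓ m : ℕ) : defPoly ℓ m ≠ 0 :=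
  mul_ne_zero (MvPolynomial.X_ne_zero _) (Finset.prod_ne_zero_iff.mpr fun _ ht =>
    linForm_ne_zero (mem_hyperplanes.mp ht).1.ne)

lemma totalDegree_defPoly (ℓ m : ℕ) :
    (defPoly ℓ m).totalDegree = 1 + (hyperplanes ℓ m).card := by
  have h := (MvPolynomial.isHomogeneous_X ℂ (Fin.last ℓ)).mul
    (MvPolynomial.IsHomogeneous.prod (hyperplanes ℓ m) (linForm ℓ) (fun _ => 1)
      fun t _ => linForm_isHomogeneous ℓ t)
  simpa [defPoly] using h.totalDegree (defPoly_ne_zero ℓ m)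

lemma defPoly_dvd {ℓ m : ℕ} {f : R ℓ} (hz : MvPolynomial.X (Fin.last ℓ) ∣ f)
    (hf : ∀ t ∈ hyperplanes ℓ m, linForm ℓ t ∣ f) : defPoly ℓ m ∣ f := by
  refine IsRelPrime.mul_dvd ?_ hz (Finset.prod_dvd_of_isRelPrime ?_ hf)
  · exact IsRelPrime.prod_right fun t ht =>
      (isRelPrime_linForm_X_last (mem_hyperplanes.mp ht).1.ne).symm
  · exact fun t ht u hu htu =>
      isRelPrime_linForm (mem_hyperplanes.mp ht).1 (mem_hyperplanes.mp hu).1 htu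

/-! ### The Saito criterion -/

lemma defPoly_dvd_det {ℓ m : ℕ} {N : Matrix (Fin (ℓ + 1)) (Fin (ℓ + 1)) (R ℓ)}
    (hN : ∀ a, N a ∈ DcCat ℓ m) : defPoly ℓ m ∣ N.det := by
  refine defPoly_dvd ?_ fun t ht => ?_
  · choose q hq using fun a => (hN a).1
    have h : N.updateCol (Fin.last ℓ) ((MvPolynomial.X (Fin.last ℓ) : R ℓ) • q) = N := by
      convert N.updateCol_eq_self (Fin.last ℓ) using 2
      exact funext fun a => (hq a).symm
    rw [← h, Matrix.det_updateCol_smul]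
    exact dvd_mul_right _ _
  · obtain ⟨i, j, p⟩ := t
    obtain ⟨hij, hp, hp'⟩ := mem_hyperplanes.mp ht
    choose q hq using fun a => (hN a).2 i j hij p hp hp'
    have hij' : i.castSucc ≠ j.castSucc := fun h => hij.ne (Fin.castSucc_injective _ h)
    have hiz : i.castSucc ≠ Fin.last ℓ := (Fin.castSucc_lt_last i).ne
    have h1 := N.det_updateCol_add_smul_self hij' (-1)
    have h2 := (N.updateCol i.castSucc fun k => N k i.castSucc + (-1 : R ℓ) •
      N k j.castSucc).det_updateCol_add_smul_self hiz (-(p : R ℓ))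
    rw [← h1, ← h2, Matrix.updateCol_idem]
    have h : (fun k => (N.updateCol i.castSucc fun k => N k i.castSucc + (-1 : R ℓ) •
        N k j.castSucc) k i.castSucc + (-(p : R ℓ)) • (N.updateCol i.castSucc fun k =>
        N k i.castSucc + (-1 : R ℓ) • N k j.castSucc) k (Fin.last ℓ)) =
        linForm ℓ (i, j, p) • q := by
      funext k
      rw [Matrix.updateCol_self, Matrix.updateCol_ne hiz.symm]
      simp only [Pi.smul_apply, smul_eq_mul, linForm, ← hq k]
      ring
    rw [h, Matrix.det_updateCol_smul]
    exact dvd_mul_right _ _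

lemma totalDegree_det_le {n : Type*} [Fintype n] [DecidableEq n] {σ : Type*}
    {N : Matrix n n (MvPolynomial σ ℂ)} {r : n → ℕ} (h : ∀ a b, (N a b).totalDegree ≤ r a) :
    N.det.totalDegree ≤ ∑ a, r a := by
  rw [Matrix.det_apply]
  refine MvPolynomial.totalDegree_finsetSum_le fun σ _ => ?_
  have hs : (Equiv.Perm.sign σ • ∏ i, N (σ i) i).totalDegree ≤
      (∏ i, N (σ i) i).totalDegree := by
    rcases Int.units_eq_one_or (Equiv.Perm.sign σ) with h | h <;> simp [h]
  refine hs.trans ((MvPolynomial.totalDegree_finsetProd _ _).trans ?_)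
  rw [← Equiv.sum_comp σ r]
  exact Finset.sum_le_sum fun i _ => h _ _

lemma linearIndependent_and_span_of_det {ℓ m : ℕ}
    {N : Matrix (Fin (ℓ + 1)) (Fin (ℓ + 1)) (R ℓ)} (hN : ∀ a, N a ∈ DcCat ℓ m)
    (hdet : N.det ≠ 0) (hdeg : N.det.totalDegree ≤ (defPoly ℓ m).totalDegree) :
    LinearIndependent (R ℓ) (fun a => N a) ∧
      ∀ v ∈ DcCat ℓ m, v ∈ Submodule.span (R ℓ) (Set.range fun a => N a) := by
  refine ⟨Matrix.linearIndependent_rows_of_det_ne_zero hdet, fun v hv => ?_⟩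
  obtain ⟨q, hq⟩ := defPoly_dvd_det hN
  have hq0 : q ≠ 0 := fun h => hdet (by rw [hq, h, mul_zero])
  rw [hq, MvPolynomial.totalDegree_mul_of_isDomain (defPoly_ne_zero ℓ m) hq0] at hdeg
  have hqC : q = MvPolynomial.C (MvPolynomial.coeff 0 q) :=
    MvPolynomial.totalDegree_eq_zero_iff_eq_C.mp (by omega)
  set c := MvPolynomial.coeff 0 q
  have hc : c ≠ 0 := fun h => hq0 (by rw [hqC, h, map_zero])
  have hrow (a) : defPoly ℓ m ∣ (N.updateRow a v).det := by
    refine defPoly_dvd_det fun b => ?_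
    by_cases hb : b = a
    · rw [hb, Matrix.updateRow_self]
      exact hv
    · rw [Matrix.updateRow_ne hb]
      exact hN b
  choose w hw using hrow
  have hcramer := N.transpose.mulVec_cramer v
  have hv' : v = ∑ a, (MvPolynomial.C c⁻¹ * w a) • N a := by
    funext b
    have hb := congrFun hcramer b
    rw [Matrix.det_transpose, Matrix.mulVec, dotProduct] at hb
    simp only [Matrix.cramer_transpose_apply, hw, Matrix.transpose_apply, Pi.smul_apply,
      smul_eq_mul, hq] at hb
    apply mul_left_cancel₀ (defPoly_ne_zero ℓ m)
    have hcc : MvPolynomial.C c * MvPolynomial.C c⁻¹ = (1 : R ℓ) := by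
      rw [← map_mul, mul_inv_cancel₀ hc, map_one]
    rw [hqC] at hb
    rw [Finset.sum_apply, Finset.mul_sum]
    simp only [Pi.smul_apply, smul_eq_mul]
    calc defPoly ℓ m * v b
        = MvPolynomial.C c⁻¹ * (defPoly ℓ m * MvPolynomial.C c * v b) := by
          linear_combination (-(defPoly ℓ m * v b)) * hcc
      _ = _ := by
          rw [← hb, Finset.mul_sum]
          exact Finset.sum_congr rfl fun a _ => by ring
  rw [hv']
  exact Submodule.sum_mem _ fun a _ =>
    Submodule.smul_mem _ _ (Submodule.subset_span (Set.mem_range_self a))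

/-! ### The determinant of the family -/

lemma totalDegree_det_catBasis_le {ℓ m : ℕ} (hℓ : 2 ≤ ℓ) {F : ℕ → Polynomial (S ℓ)}
    (hF : ∀ k : ℕ,
      (F k).comp (Polynomial.X + 1) - F k = Polynomial.X ^ k * fpow (gpoly ℓ) m) :
    ((Matrix.of (catBasis ℓ F)).det).totalDegree ≤ (defPoly ℓ m).totalDegree := by
  have h := totalDegree_det_le (N := Matrix.of (catBasis ℓ F))
    (r := fun a => if (a : ℕ) < ℓ - 1 then (a : ℕ) + m * ℓ + 1
      else if (a : ℕ) = ℓ - 1 then 0 else 1) fun a b => by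
    rw [Matrix.of_apply, catBasis]
    split_ifs
    · induction b using Fin.lastCases with
      | last => simp [vfHomog_last]
      | cast i =>
        rw [vfHomog_castSucc]
        refine (totalDegree_homog_le _ _ _ ?_).trans
          (Finset.sup_le fun i _ => totalDegree_zetaVF_le (hF a) i)
        exact Finset.le_sup (f := fun a => (zetaVF ℓ (F _) a).totalDegree) (Finset.mem_univ i)
    · rw [theta0c]
      split_ifs <;> simp
    · simp [thetaE]
  refine h.trans ?_
  obtain ⟨n, rfl⟩ : ∃ n, ℓ = n + 1 := ⟨ℓ - 1, by omega⟩
  rw [totalDegree_defPoly, Fin.sum_univ_castSucc, Fin.sum_univ_castSucc]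
  have hsum : ∑ i : Fin n, ((i : ℕ) + m * (n + 1) + 1) =
      (∑ i ∈ Finset.range n, i) + n * (m * (n + 1) + 1) := by
    rw [Fin.sum_univ_eq_sum_range (fun i => i + m * (n + 1) + 1)]
    simp only [add_assoc, Finset.sum_add_distrib]
    simp
    ring
  have hid := Finset.sum_range_id_mul_two n
  have hcard := two_mul_card_hyperplanes (n + 1) m
  simp only [Fin.val_castSucc, Fin.is_lt, Fin.val_last, Nat.add_sub_cancel, if_true, lt_irrefl,
    if_false, hsum] at hcard ⊢
  obtain ⟨n, rfl⟩ : ∃ k, n = k + 1 := ⟨n - 1, by omega⟩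
  simp only [Nat.add_sub_cancel] at hid
  have : ¬ (n + 1 + 1 < n + 1) := by omega
  simp only [this, if_false, Nat.succ_ne_self]
  nlinarith

lemma eval_fpow_prod_ne_zero {ℓ m : ℕ} (i : ℕ) :
    (fpow (∏ p : Fin ℓ, (Polynomial.X - Polynomial.C (((m + 1) * p : ℕ) : ℂ))) m).eval
      (((m + 1) * i + m : ℕ) : ℂ) ≠ 0 := by
  rw [fpow, Polynomial.eval_prod, Finset.prod_ne_zero_iff]
  intro s hs
  rw [Polynomial.eval_comp, Polynomial.eval_prod, Finset.prod_ne_zero_iff]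
  intro p _
  have hs := Finset.mem_range.mp hs
  simp only [Polynomial.eval_sub, Polynomial.eval_X, Polynomial.eval_C, Polynomial.eval_natCast]
  rw [sub_sub, sub_ne_zero]
  norm_cast
  intro h
  have h' : (m + 1) * i + (m - s) = (m + 1) * (p : ℕ) := by omega
  have h2 : (m + 1) ∣ m - s :=
    (Nat.dvd_add_right (dvd_mul_right (m + 1) i)).mp (h' ▸ dvd_mul_right _ _)
  have := Nat.le_of_dvd (by omega) h2
  omega

lemma eval_sub_eval_eq {ℓ m k : ℕ} {G : Polynomial ℂ}
    (hG : G.comp (Polynomial.X + 1) - G = Polynomial.X ^ k *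
      fpow (∏ p : Fin ℓ, (Polynomial.X - Polynomial.C (((m + 1) * p : ℕ) : ℂ))) m)
    {i : ℕ} (hi : i < ℓ) :
    G.eval (((m + 1) * (i + 1) : ℕ) : ℂ) - G.eval (((m + 1) * i : ℕ) : ℂ) =
      (((m + 1) * i + m : ℕ) : ℂ) ^ k *
        (fpow (∏ p : Fin ℓ, (Polynomial.X - Polynomial.C (((m + 1) * p : ℕ) : ℂ))) m).eval
          (((m + 1) * i + m : ℕ) : ℂ) := by
  have h := eval_add_nat_sub_eval hG (((m + 1) * i : ℕ) : ℂ) (m + 1)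
  have hroot : (∏ p : Fin ℓ, (Polynomial.X - Polynomial.C (((m + 1) * p : ℕ) : ℂ))).eval
      (((m + 1) * i : ℕ) : ℂ) = 0 := by
    rw [Polynomial.eval_prod]
    exact Finset.prod_eq_zero (Finset.mem_univ ⟨i, hi⟩) (by simp)
  rw [Finset.sum_range_succ, Finset.sum_eq_zero fun s hs => ?_, zero_add, ← Nat.cast_add,
    ← Nat.cast_add, Polynomial.eval_mul, Polynomial.eval_pow, Polynomial.eval_X] at h
  · exact h
  · rw [Polynomial.eval_mul, eval_fpow_eq_zero hroot (Finset.mem_range.mp hs), mul_zero]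

lemma det_catBasis_ne_zero {ℓ m : ℕ} (hℓ : 2 ≤ ℓ) {F : ℕ → Polynomial (S ℓ)}
    (hF : ∀ k : ℕ,
      (F k).comp (Polynomial.X + 1) - F k = Polynomial.X ^ k * fpow (gpoly ℓ) m) :
    (Matrix.of (catBasis ℓ F)).det ≠ 0 := by
  obtain ⟨n, rfl⟩ : ∃ n, ℓ = n + 1 := ⟨ℓ - 1, by omega⟩
  intro hdet
  set x : Fin (n + 1) → ℂ := fun p => (((m + 1) * p : ℕ) : ℂ) with hx
  set φ : R (n + 1) →+* ℂ := MvPolynomial.eval (Fin.snoc x 1) with hφ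
  set G : ℕ → Polynomial ℂ := fun k => (F k).map (MvPolynomial.eval x) with hGdef
  set g : Polynomial ℂ :=
    ∏ p : Fin (n + 1), (Polynomial.X - Polynomial.C (((m + 1) * p : ℕ) : ℂ)) with hg
  have hG (k : ℕ) : (G k).comp (Polynomial.X + 1) - G k = Polynomial.X ^ k * fpow g m := by
    have := congr(($(hF k)).map (MvPolynomial.eval x))
    simpa [hGdef, fpow, gpoly, hg, Polynomial.map_comp, Polynomial.map_prod, hx] using this
  have hdet' : (φ.mapMatrix (Matrix.of (catBasis (n + 1) F))).det = 0 := by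
    rw [← RingHom.map_det, hdet, map_zero]
  obtain ⟨c, hc0, hc⟩ := Matrix.exists_vecMul_eq_zero_iff.mpr hdet'
  have heval (k : ℕ) (i : Fin (n + 1)) :
      MvPolynomial.eval x ((F k).eval (MvPolynomial.X i)) = (G k).eval (x i) := by
    rw [hGdef, Polynomial.eval_map, ← Polynomial.eval₂_at_apply, MvPolynomial.eval_X]
  have hzeta (k : ℕ) (i : Fin (n + 1)) : φ (vfHomog (n + 1) (zetaVF (n + 1) (F k)) i.castSucc) =
      ∑ j, ((G k).eval (x j) - (G k).eval (x i)) := by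
    rw [vfHomog_castSucc, hφ, eval_homog _ _ _ _ (by simp)]
    simp only [Fin.snoc_castSucc]
    rw [zetaVF, map_sum]
    exact Finset.sum_congr rfl fun j _ => by rw [map_sub, heval, heval]
  have hrow (a : Fin n) : catBasis (n + 1) F a.castSucc.castSucc =
      vfHomog (n + 1) (zetaVF (n + 1) (F a)) := by
    simp [catBasis]
  have hrow0 : catBasis (n + 1) F (Fin.last n).castSucc = theta0c (n + 1) := by
    simp [catBasis]
  have hrowE : catBasis (n + 1) F (Fin.last (n + 1)) = thetaE (n + 1) := by
    simp [catBasis]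
  have hcol (b : Fin (n + 2)) : ∑ a : Fin n,
      c a.castSucc.castSucc * φ (vfHomog (n + 1) (zetaVF (n + 1) (F a)) b) +
      c (Fin.last n).castSucc * φ (theta0c (n + 1) b) +
      c (Fin.last (n + 1)) * φ (thetaE (n + 1) b) = 0 := by
    have h : ∑ a, c a * φ (catBasis (n + 1) F a b) = 0 := congrFun hc b
    rw [Fin.sum_univ_castSucc, Fin.sum_univ_castSucc, hrow0, hrowE] at h
    simpa only [hrow] using h
  have hlast : c (Fin.last _) = 0 := by
    simpa [vfHomog_last, theta0c, thetaE, hφ] using hcol (Fin.last _)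
  have hcol' (i : Fin (n + 1)) : ∑ a : Fin n, c a.castSucc.castSucc *
      (∑ j, ((G a).eval (x j) - (G a).eval (x i))) + c (Fin.last n).castSucc = 0 := by
    have := hcol i.castSucc
    simp only [hlast, hzeta, zero_mul, add_zero] at this
    simpa [theta0c, Nat.lt_succ_iff.mp i.is_lt] using this
  set q : Polynomial ℂ := ∑ a : Fin n, Polynomial.C (c a.castSucc.castSucc) *
    Polynomial.X ^ (a : ℕ) with hq
  have hroot (i : Fin n) : q.eval (((m + 1) * i + m : ℕ) : ℂ) = 0 := by
    have h : ∑ a : Fin n, c a.castSucc.castSucc *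
        ((n + 1 : ℂ) * ((G a).eval (x i.succ) - (G a).eval (x i.castSucc))) = 0 := by
      have h' := (sub_eq_zero.mpr ((hcol' i.castSucc).trans (hcol' i.succ).symm))
      rw [add_sub_add_right_eq_sub, ← Finset.sum_sub_distrib] at h'
      rw [← h']
      refine Finset.sum_congr rfl fun a _ => ?_
      rw [← mul_sub, ← Finset.sum_sub_distrib]
      simp [mul_sub]
    have hG' (a : ℕ) : (G a).eval (x i.succ) - (G a).eval (x i.castSucc) = _ :=
      eval_sub_eval_eq (hG a) (i := i) (by omega)
    simp only [hG'] at h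
    have hne : ((n + 1 : ℂ) * (fpow g m).eval (((m + 1) * i + m : ℕ) : ℂ)) ≠ 0 :=
      mul_ne_zero (Nat.cast_add_one_ne_zero n) (eval_fpow_prod_ne_zero i)
    refine (mul_eq_zero.mp (?_ : q.eval _ * _ = 0)).resolve_right hne
    rw [← h, hq, Polynomial.eval_finsetSum, Finset.sum_mul]
    refine Finset.sum_congr rfl fun a _ => ?_
    rw [Polynomial.eval_mul, Polynomial.eval_C, Polynomial.eval_pow, Polynomial.eval_X]
    ring
  have hq0 : q = 0 := by
    have hdeg : q.degree < n := by
      rw [hq, Polynomial.degree_lt_iff_coeff_zero]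
      intro k hk
      rw [Polynomial.finsetSum_coeff]
      refine Finset.sum_eq_zero fun a _ => ?_
      rw [Polynomial.coeff_C_mul_X_pow, if_neg (by omega)]
    refine Polynomial.eq_zero_of_degree_lt_of_eval_index_eq_zero (s := Finset.univ)
      (v := fun i : Fin n => (((m + 1) * i + m : ℕ) : ℂ)) ?_ (by simpa using hdeg)
      fun i _ => hroot i
    intro i _ j _ hij
    have hij' : (m + 1) * (i : ℕ) + m = (m + 1) * j + m := Nat.cast_injective hij
    exact Fin.ext (Nat.eq_of_mul_eq_mul_left m.succ_pos (Nat.add_right_cancel hij'))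
  have hcoeff (a : Fin n) : c a.castSucc.castSucc = 0 := by
    have := congr(Polynomial.coeff $hq0 a)
    simpa [hq, Polynomial.finsetSum_coeff, Polynomial.coeff_X_pow, Fin.val_inj] using this
  have htheta : c (Fin.last n).castSucc = 0 := by
    simpa [hcoeff] using hcol' 0
  refine hc0 (funext fun b => ?_)
  induction b using Fin.lastCases with
  | last => exact hlast
  | cast b =>
    induction b using Fin.lastCases with
    | last => exact htheta
    | cast a => exact hcoeff a

theorem stmt11 (ℓ m : ℕ) (hℓ : 2 ≤ ℓ) (hm : 1 ≤ m)
    -- F k is an indefinite summation (antidifference) of t^k g(t)^{\underline{m}}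
    (F : ℕ → Polynomial (S ℓ))
    (hF : ∀ k : ℕ,
      (F k).comp (Polynomial.X + 1) - F k = Polynomial.X ^ k * fpow (gpoly ℓ) m) :
    (∀ a : Fin (ℓ + 1), catBasis ℓ F a ∈ DcCat ℓ m) ∧
    LinearIndependent (R ℓ) (catBasis ℓ F) ∧
    (∀ v ∈ DcCat ℓ m,
      v ∈ Submodule.span (R ℓ) (Set.range (catBasis ℓ F))) := by
  have hmem := catBasis_mem hF
  obtain ⟨hli, hspan⟩ := linearIndependent_and_span_of_det (N := Matrix.of (catBasis ℓ F)) hmem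
    (det_catBasis_ne_zero hℓ hF) (totalDegree_det_catBasis_le hℓ hF)
  exact ⟨hmem, hli, hspan⟩

end
end

section
/- Let ℓ ≥ 2 and m ≥ 1 be integers. The module D(cShi_ℓ(m)) is a free ℂ[x_1,…,x_ℓ,z]-module of rank ℓ + 1 admitting a basis of homogeneous elements of degrees 0, 1, and mℓ repeated ℓ − 1 times. -/
open MvPolynomial Polynomial

noncomputable section

/-- D(cShi_ℓ(m)). -/
def DcShi (ℓ m : ℕ) : Submodule (R ℓ) (Fin (ℓ + 1) → R ℓ) where
  carrier := {f | MvPolynomial.X (Fin.last ℓ) ∣ f (Fin.last ℓ) ∧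
    ∀ i j : Fin ℓ, i < j → ∀ p : ℤ, 1 - (m : ℤ) ≤ p → p ≤ m →
      (MvPolynomial.X i.castSucc - MvPolynomial.X j.castSucc -
          (p : R ℓ) * MvPolynomial.X (Fin.last ℓ)) ∣
        (f i.castSucc - f j.castSucc - (p : R ℓ) * f (Fin.last ℓ))}
  zero_mem' := by
    refine ⟨by simp, ?_⟩
    intro i j _ p _ _
    simp
  add_mem' := by
    intro f g hf hg
    refine ⟨?_, ?_⟩
    · have := hf.1.add hg.1
      simpa using this
    · intro i j hij p hp1 hp2
      have h := (hf.2 i j hij p hp1 hp2).add (hg.2 i j hij p hp1 hp2)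
      have e : (f i.castSucc - f j.castSucc - (p : R ℓ) * f (Fin.last ℓ)) +
          (g i.castSucc - g j.castSucc - (p : R ℓ) * g (Fin.last ℓ)) =
          (f + g) i.castSucc - (f + g) j.castSucc - (p : R ℓ) * (f + g) (Fin.last ℓ) := by
        simp only [Pi.add_apply]; ring
      rwa [e] at h
  smul_mem' := by
    intro c f hf
    refine ⟨?_, ?_⟩
    · have := hf.1.mul_left c
      simpa using this
    · intro i j hij p hp1 hp2
      have h := (hf.2 i j hij p hp1 hp2).mul_left c
      have e : c * (f i.castSucc - f j.castSucc - (p : R ℓ) * f (Fin.last ℓ)) =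
          (c • f) i.castSucc - (c • f) j.castSucc - (p : R ℓ) * (c • f) (Fin.last ℓ) := by
        simp only [Pi.smul_apply, smul_eq_mul]; ring
      rwa [e] at h

/-- The polynomials in `t` over `R ℓ` that are homogeneous of degree `d` jointly in all variables. -/
def jointlyHomogeneous (ℓ d : ℕ) : AddSubgroup (Polynomial (R ℓ)) :=
  AddSubgroup.closure {p | ∃ (n e : ℕ) (r : R ℓ), r.IsHomogeneous e ∧ e + n = d ∧
    p = Polynomial.monomial n r}

lemma monomial_mem_jointlyHomogeneous {ℓ n e d : ℕ} {r : R ℓ} (hr : r.IsHomogeneous e)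
    (h : e + n = d) : Polynomial.monomial n r ∈ jointlyHomogeneous ℓ d :=
  AddSubgroup.subset_closure ⟨n, e, r, hr, h, rfl⟩

lemma C_mem_jointlyHomogeneous {ℓ d : ℕ} {r : R ℓ} (hr : r.IsHomogeneous d) :
    Polynomial.C r ∈ jointlyHomogeneous ℓ d :=
  monomial_mem_jointlyHomogeneous hr rfl

lemma X_pow_mem_jointlyHomogeneous (ℓ n : ℕ) :
    (Polynomial.X ^ n : Polynomial (R ℓ)) ∈ jointlyHomogeneous ℓ n := by
  rw [Polynomial.X_pow_eq_monomial]
  exact monomial_mem_jointlyHomogeneous (MvPolynomial.isHomogeneous_one _ _) (zero_add n)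

lemma mul_mem_jointlyHomogeneous {ℓ d e : ℕ} {p q : Polynomial (R ℓ)}
    (hp : p ∈ jointlyHomogeneous ℓ d) (hq : q ∈ jointlyHomogeneous ℓ e) :
    p * q ∈ jointlyHomogeneous ℓ (d + e) := by
  induction hp using AddSubgroup.closure_induction with
  | mem p hp =>
    obtain ⟨n, a, r, hr, rfl, rfl⟩ := hp
    induction hq using AddSubgroup.closure_induction with
    | mem q hq =>
      obtain ⟨n', a', r', hr', rfl, rfl⟩ := hq
      rw [Polynomial.monomial_mul_monomial]
      exact monomial_mem_jointlyHomogeneous (hr.mul hr') (by ring)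
    | zero => simp
    | add x y _ _ hx hy => rw [mul_add]; exact add_mem hx hy
    | neg x _ hx => exact (mul_neg (Polynomial.monomial n r) x).symm ▸ neg_mem hx
  | zero => simp
  | add x y _ _ hx hy => rw [add_mul]; exact add_mem hx hy
  | neg x _ hx => exact (neg_mul x q).symm ▸ neg_mem hx

lemma sub_mem_jointlyHomogeneous {ℓ d : ℕ} {p q : Polynomial (R ℓ)}
    (hp : p ∈ jointlyHomogeneous ℓ d) (hq : q ∈ jointlyHomogeneous ℓ d) :
    p - q ∈ jointlyHomogeneous ℓ d :=
  sub_mem hp hq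

lemma sum_mem_jointlyHomogeneous {ℓ d : ℕ} {ι : Type*} (s : Finset ι) (p : ι → Polynomial (R ℓ))
    (h : ∀ i ∈ s, p i ∈ jointlyHomogeneous ℓ d) : ∑ i ∈ s, p i ∈ jointlyHomogeneous ℓ d :=
  sum_mem h

lemma prod_mem_jointlyHomogeneous {ℓ : ℕ} {ι : Type*} (s : Finset ι) (p : ι → Polynomial (R ℓ))
    (d : ι → ℕ) (h : ∀ i ∈ s, p i ∈ jointlyHomogeneous ℓ (d i)) :
    ∏ i ∈ s, p i ∈ jointlyHomogeneous ℓ (∑ i ∈ s, d i) := by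
  classical
  induction s using Finset.induction_on with
  | empty => simpa using X_pow_mem_jointlyHomogeneous ℓ 0
  | insert a s ha ih =>
    rw [Finset.prod_insert ha, Finset.sum_insert ha]
    exact mul_mem_jointlyHomogeneous (h a (Finset.mem_insert_self a s))
      (ih fun i hi => h i (Finset.mem_insert_of_mem hi))

lemma natDegree_le_of_mem_jointlyHomogeneous {ℓ d : ℕ} {p : Polynomial (R ℓ)}
    (hp : p ∈ jointlyHomogeneous ℓ d) : p.natDegree ≤ d := by
  induction hp using AddSubgroup.closure_induction with
  | mem p hp =>
    obtain ⟨n, a, r, hr, rfl, rfl⟩ := hp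
    exact (Polynomial.natDegree_monomial_le r).trans (Nat.le_add_left _ _)
  | zero => simp
  | add x y _ _ hx hy => exact Polynomial.natDegree_add_le_of_degree_le hx hy
  | neg x _ hx => rwa [Polynomial.natDegree_neg]

lemma isHomogeneous_eval_of_mem_jointlyHomogeneous {ℓ d : ℕ} {p : Polynomial (R ℓ)}
    (hp : p ∈ jointlyHomogeneous ℓ d) {r : R ℓ} (hr : r.IsHomogeneous 1) :
    (p.eval r).IsHomogeneous d := by
  induction hp using AddSubgroup.closure_induction with
  | mem p hp =>
    obtain ⟨n, a, c, hc, rfl, rfl⟩ := hp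
    rw [Polynomial.eval_monomial]
    simpa using hc.mul (hr.pow n)
  | zero => simpa using MvPolynomial.isHomogeneous_zero _ _ _
  | add x y _ _ hx hy => rw [Polynomial.eval_add]; exact hx.add hy
  | neg x _ hx => rw [Polynomial.eval_neg]; exact hx.neg

lemma exists_difference_eq_X_pow {ℓ : ℕ} {z : R ℓ} (hz : z.IsHomogeneous 1) (n : ℕ) :
    ∃ S ∈ jointlyHomogeneous ℓ (n + 1),
      S.comp (Polynomial.X + Polynomial.C z) - S = Polynomial.C z * Polynomial.X ^ n := by
  induction n using Nat.strong_induction_on with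
  | _ n ih =>
    choose S hS hSd using ih
    set c : R ℓ := MvPolynomial.C ((n : ℂ) + 1)⁻¹ with hc
    have hcn : c * ((n : R ℓ) + 1) = 1 := by
      have h1 : ((n : R ℓ) + 1) = MvPolynomial.C ((n : ℂ) + 1) := by simp
      rw [h1, hc, ← map_mul, inv_mul_cancel₀ (Nat.cast_add_one_ne_zero n), map_one]
    set a : ℕ → R ℓ := fun j => (Nat.choose (n + 1) j : R ℓ) * z ^ (n - j) with ha
    refine ⟨Polynomial.C c * (Polynomial.X ^ (n + 1) -
      ∑ j : Fin n, Polynomial.C (a j) * S j j.2), ?_, ?_⟩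
    · have hmem : ∀ j : Fin n, Polynomial.C (a j) * S j j.2 ∈ jointlyHomogeneous ℓ (n + 1) := by
        intro j
        have h1 := (MvPolynomial.isHomogeneous_C (Fin (ℓ + 1)) (Nat.choose (n + 1) j : ℂ)).mul
          (hz.pow (n - j))
        rw [zero_add, one_mul, map_natCast] at h1
        have := mul_mem_jointlyHomogeneous (C_mem_jointlyHomogeneous h1) (hS j j.2)
        rwa [show n - (j : ℕ) + (j + 1) = n + 1 by have := j.2; omega] at this
      have h := sub_mem_jointlyHomogeneous (X_pow_mem_jointlyHomogeneous ℓ (n + 1))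
        (sum_mem_jointlyHomogeneous Finset.univ _ fun j _ => hmem j)
      have h0 := mul_mem_jointlyHomogeneous
        (C_mem_jointlyHomogeneous (MvPolynomial.isHomogeneous_C (Fin (ℓ + 1)) ((n : ℂ) + 1)⁻¹)) h
      rwa [zero_add] at h0
    · have hsum : ∑ j : Fin n, Polynomial.C (a j) *
          ((S j j.2).comp (Polynomial.X + Polynomial.C z) - S j j.2) =
          ∑ j ∈ Finset.range n, Polynomial.C (a j) * (Polynomial.C z * Polynomial.X ^ j) := by
        rw [← Fin.sum_univ_eq_sum_range
          (fun j => Polynomial.C (a j) * (Polynomial.C z * Polynomial.X ^ j))]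
        exact Finset.sum_congr rfl fun j _ => by rw [hSd]
      have hpow : (Polynomial.X + Polynomial.C z) ^ (n + 1) - Polynomial.X ^ (n + 1) =
          ∑ j ∈ Finset.range n, Polynomial.C (a j) * (Polynomial.C z * Polynomial.X ^ j) +
            Polynomial.C z * Polynomial.X ^ n * Polynomial.C ((n : R ℓ) + 1) := by
        rw [add_pow, Finset.sum_range_succ, Finset.sum_range_succ]
        have : ∀ j ∈ Finset.range n, Polynomial.X ^ j * Polynomial.C z ^ (n + 1 - j) *
            ((n + 1).choose j : Polynomial (R ℓ)) =
            Polynomial.C (a j) * (Polynomial.C z * Polynomial.X ^ j) := by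
          intro j hj
          rw [Finset.mem_range] at hj
          rw [show n + 1 - j = n - j + 1 by omega]
          simp only [ha, Polynomial.C_mul, Polynomial.C_pow, Polynomial.C_eq_natCast]
          ring
        rw [Finset.sum_congr rfl this]
        simp
      have hcn' : Polynomial.C c * Polynomial.C ((n : R ℓ) + 1) = 1 := by
        rw [← Polynomial.C_mul, hcn, Polynomial.C_1]
      simp only [mul_sub, Finset.sum_sub_distrib] at hsum
      simp only [Polynomial.mul_comp, Polynomial.sub_comp, Polynomial.C_comp,
        Polynomial.X_pow_comp, Polynomial.sum_comp]
      linear_combination Polynomial.C c * hpow - Polynomial.C c * hsum +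
        Polynomial.C z * Polynomial.X ^ n * hcn'

/-- Discrete integration with step `z` raises the joint degree by one. -/
lemma exists_difference_eq {ℓ d : ℕ} {z : R ℓ} (hz : z.IsHomogeneous 1) {G : Polynomial (R ℓ)}
    (hG : G ∈ jointlyHomogeneous ℓ d) :
    ∃ F ∈ jointlyHomogeneous ℓ (d + 1),
      F.comp (Polynomial.X + Polynomial.C z) - F = Polynomial.C z * G := by
  induction hG using AddSubgroup.closure_induction with
  | mem p hp =>
    obtain ⟨n, e, r, hr, rfl, rfl⟩ := hp
    obtain ⟨S, hS, hSd⟩ := exists_difference_eq_X_pow hz n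
    refine ⟨Polynomial.C r * S, ?_, ?_⟩
    · rw [add_assoc]
      exact mul_mem_jointlyHomogeneous (C_mem_jointlyHomogeneous hr) hS
    · rw [Polynomial.mul_comp, Polynomial.C_comp, ← Polynomial.C_mul_X_pow_eq_monomial]
      linear_combination Polynomial.C r * hSd
  | zero => exact ⟨0, zero_mem _, by simp⟩
  | add x y _ _ hx hy =>
    obtain ⟨F, hF, hFd⟩ := hx
    obtain ⟨F', hF', hFd'⟩ := hy
    refine ⟨F + F', add_mem hF hF', ?_⟩
    rw [Polynomial.add_comp]
    linear_combination hFd + hFd'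
  | neg x _ hx =>
    obtain ⟨F, hF, hFd⟩ := hx
    refine ⟨-F, neg_mem hF, ?_⟩
    rw [Polynomial.neg_comp]
    linear_combination -hFd

/-- The linear form `x_i + a z`. -/
def shiftedVar {ℓ : ℕ} (i : Fin ℓ) (a : ℤ) : R ℓ :=
  MvPolynomial.X i.castSucc + (a : R ℓ) * MvPolynomial.X (Fin.last ℓ)

lemma isHomogeneous_int_mul_X (ℓ : ℕ) (a : ℤ) (i : Fin (ℓ + 1)) :
    ((a : R ℓ) * MvPolynomial.X i).IsHomogeneous 1 := by
  simpa using MvPolynomial.isHomogeneous_C_mul_X (a : ℂ) i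

lemma isHomogeneous_shiftedVar {ℓ : ℕ} (i : Fin ℓ) (a : ℤ) : (shiftedVar i a).IsHomogeneous 1 :=
  (MvPolynomial.isHomogeneous_X _ _).add (isHomogeneous_int_mul_X _ _ _)

lemma shiftedVar_zero {ℓ : ℕ} (i : Fin ℓ) : shiftedVar i 0 = MvPolynomial.X i.castSucc := by
  simp [shiftedVar]

lemma shiftedVar_add_one {ℓ : ℕ} (i : Fin ℓ) (a : ℤ) :
    shiftedVar i (a + 1) = shiftedVar i a + MvPolynomial.X (Fin.last ℓ) := by
  simp [shiftedVar]; ring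

lemma shiftedVar_inj {ℓ : ℕ} {i j : Fin ℓ} {a b : ℤ} (h : shiftedVar i a = shiftedVar j b) :
    i = j ∧ a = b := by
  have hij : i = j := by
    by_contra hne
    have := congrArg (MvPolynomial.eval (Pi.single i.castSucc (1 : ℂ))) h
    have h1 : Fin.last ℓ ≠ i.castSucc := (Fin.castSucc_lt_last i).ne'
    have h2 : j.castSucc ≠ i.castSucc := fun e => hne (Fin.castSucc_injective _ e).symm
    simp [shiftedVar, h1, h2] at this
  subst hij
  refine ⟨rfl, ?_⟩
  have := congrArg (MvPolynomial.eval (Pi.single (Fin.last ℓ) (1 : ℂ))) h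
  have h1 : i.castSucc ≠ Fin.last ℓ := (Fin.castSucc_lt_last i).ne
  simpa [shiftedVar, h1] using this

lemma X_sub_C_mem_jointlyHomogeneous {ℓ : ℕ} {r : R ℓ} (hr : r.IsHomogeneous 1) :
    Polynomial.X - Polynomial.C r ∈ jointlyHomogeneous ℓ 1 :=
  sub_mem (by simpa using X_pow_mem_jointlyHomogeneous ℓ 1) (C_mem_jointlyHomogeneous hr)

/-- The polynomial in `t` whose discrete integrals, evaluated at `x_1, …, x_ℓ`, give a derivation
of the cone over the extended Shi arrangement with parameter `k + 1`. -/
def shiIntegrand (ℓ k n : ℕ) : Polynomial (R ℓ) :=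
  ∏ i : Fin ℓ, ((∏ s ∈ Finset.range k, (Polynomial.X - Polynomial.C (shiftedVar i s))) *
    (if (i : ℕ) < n then Polynomial.X - Polynomial.C (shiftedVar i (-1))
      else if n < (i : ℕ) then Polynomial.X - Polynomial.C (shiftedVar i k) else 1))

lemma shiIntegrand_mem_jointlyHomogeneous {ℓ k n : ℕ} (hn : n < ℓ) :
    shiIntegrand ℓ k n ∈ jointlyHomogeneous ℓ ((k + 1) * ℓ - 1) := by
  have hsum : ∑ i : Fin ℓ, (k + if i = ⟨n, hn⟩ then 0 else 1) = (k + 1) * ℓ - 1 := by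
    have h : ∑ i : Fin ℓ, ((k + if i = ⟨n, hn⟩ then 0 else 1) + if i = ⟨n, hn⟩ then 1 else 0) =
        (k + 1) * ℓ := by
      rw [Finset.sum_congr rfl (g := fun _ => k + 1)]
      · simp [mul_comm]
      · intro i _
        split_ifs <;> rfl
    rw [Finset.sum_add_distrib, Finset.sum_ite_eq' Finset.univ] at h
    simp only [Finset.mem_univ, if_true] at h
    omega
  rw [← hsum]
  refine prod_mem_jointlyHomogeneous _ _ _ fun i _ => mul_mem_jointlyHomogeneous ?_ ?_
  · simpa using prod_mem_jointlyHomogeneous (Finset.range k)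
      (fun s => Polynomial.X - Polynomial.C (shiftedVar i s)) (fun _ => 1)
      fun s _ => X_sub_C_mem_jointlyHomogeneous (isHomogeneous_shiftedVar i s)
  · rcases lt_trichotomy (i : ℕ) n with h | h | h
    · rw [if_pos h, if_neg (by rintro rfl; exact lt_irrefl _ h)]
      exact X_sub_C_mem_jointlyHomogeneous (isHomogeneous_shiftedVar _ _)
    · rw [if_neg h.not_lt, if_neg h.not_gt, if_pos (Fin.ext h)]
      simpa using X_pow_mem_jointlyHomogeneous ℓ 0
    · rw [if_neg h.not_gt, if_pos h, if_neg (by rintro rfl; exact lt_irrefl _ h)]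
      exact X_sub_C_mem_jointlyHomogeneous (isHomogeneous_shiftedVar _ _)

lemma eval_shiIntegrand_dvd {ℓ k n : ℕ} (i : Fin ℓ) (r : R ℓ) :
    ((∏ s ∈ Finset.range k, (r - shiftedVar i s)) *
      (if (i : ℕ) < n then r - shiftedVar i (-1)
        else if n < (i : ℕ) then r - shiftedVar i k else 1)) ∣ (shiIntegrand ℓ k n).eval r := by
  have h : (shiIntegrand ℓ k n).eval r =
      ∏ i : Fin ℓ, ((∏ s ∈ Finset.range k, (r - shiftedVar i s)) *
      (if (i : ℕ) < n then r - shiftedVar i (-1)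
        else if n < (i : ℕ) then r - shiftedVar i k else 1)) := by
    rw [shiIntegrand, Polynomial.eval_prod]
    refine Finset.prod_congr rfl fun i _ => ?_
    rw [Polynomial.eval_mul, Polynomial.eval_prod]
    split_ifs <;> simp
  rw [h]
  exact Finset.dvd_prod_of_mem _ (Finset.mem_univ i)

lemma eval_shiIntegrand_shiftedVar_eq_zero {ℓ k n s : ℕ} (hs : s < k) (i : Fin ℓ) :
    (shiIntegrand ℓ k n).eval (shiftedVar i s) = 0 := by
  refine eq_zero_of_zero_dvd (dvd_trans ?_ (eval_shiIntegrand_dvd i _))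
  rw [Finset.prod_eq_zero (Finset.mem_range.2 hs) (sub_self _), zero_mul]

lemma eval_shiIntegrand_shiftedVar_of_lt {ℓ k n : ℕ} {i : Fin ℓ} (hi : n < (i : ℕ)) :
    (shiIntegrand ℓ k n).eval (shiftedVar i k) = 0 := by
  refine eq_zero_of_zero_dvd (dvd_trans ?_ (eval_shiIntegrand_dvd i _))
  rw [if_neg hi.not_gt, if_pos hi, sub_self, mul_zero]

lemma sub_shiftedVar_dvd_eval_shiIntegrand {ℓ k n : ℕ} {i : Fin ℓ} (hi : (i : ℕ) < n) (r : R ℓ) :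
    r - shiftedVar i (-1) ∣ (shiIntegrand ℓ k n).eval r := by
  refine dvd_trans ?_ (eval_shiIntegrand_dvd i _)
  rw [if_pos hi]
  exact dvd_mul_left _ _

lemma eval_shiIntegrand_ne_zero {ℓ k : ℕ} (n : Fin ℓ) :
    (shiIntegrand ℓ k n).eval (shiftedVar n (-1)) ≠ 0 := by
  rw [shiIntegrand, Polynomial.eval_prod, Finset.prod_ne_zero_iff]
  intro i _
  rw [Polynomial.eval_mul, Polynomial.eval_prod]
  refine mul_ne_zero (Finset.prod_ne_zero_iff.2 fun s _ => ?_) ?_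
  · rw [Polynomial.eval_sub, Polynomial.eval_X, Polynomial.eval_C, sub_ne_zero]
    intro h
    have := (shiftedVar_inj h).2
    omega
  · split_ifs with h1 h2
    · rw [Polynomial.eval_sub, Polynomial.eval_X, Polynomial.eval_C, sub_ne_zero]
      intro h
      rw [(shiftedVar_inj h).1] at h1
      exact lt_irrefl _ h1
    · rw [Polynomial.eval_sub, Polynomial.eval_X, Polynomial.eval_C, sub_ne_zero]
      intro h
      have := (shiftedVar_inj h).2
      omega
    · simp

lemma eval_shiftedVar_eq {ℓ : ℕ} {F G : Polynomial (R ℓ)} {z : R ℓ}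
    (h : F.comp (Polynomial.X + Polynomial.C z) - F = Polynomial.C z * G) (r : R ℓ) :
    F.eval (r + z) = F.eval r + z * G.eval r := by
  have := congrArg (Polynomial.eval r) h
  simp only [Polynomial.eval_sub, Polynomial.eval_comp, Polynomial.eval_add, Polynomial.eval_X,
    Polynomial.eval_C, Polynomial.eval_mul] at this
  linear_combination this

/-- A discrete integral takes the same value along a string of zeros of its difference. -/
lemma eval_shiftedVar_eq_of_forall {ℓ : ℕ} {F G : Polynomial (R ℓ)}
    (h : F.comp (Polynomial.X + Polynomial.C (MvPolynomial.X (Fin.last ℓ))) - F =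
      Polynomial.C (MvPolynomial.X (Fin.last ℓ)) * G) (i : Fin ℓ) (s : ℕ)
    (hG : ∀ t : ℕ, t < s → G.eval (shiftedVar i t) = 0) :
    F.eval (shiftedVar i s) = F.eval (MvPolynomial.X i.castSucc) := by
  induction s with
  | zero => rw [Nat.cast_zero, shiftedVar_zero]
  | succ s ih =>
    rw [Nat.cast_succ, shiftedVar_add_one, eval_shiftedVar_eq h, hG s (Nat.lt_succ_self s),
      mul_zero, add_zero, ih fun t ht => hG t (ht.trans (Nat.lt_succ_self s))]

/-- The tuple of values at `x_1, …, x_ℓ` of a polynomial, with last entry `0`. -/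
def evalVars {ℓ : ℕ} (F : Polynomial (R ℓ)) : Fin (ℓ + 1) → R ℓ :=
  Fin.snoc (α := fun _ => R ℓ) (fun i : Fin ℓ => F.eval (MvPolynomial.X i.castSucc)) 0

lemma evalVars_mem_DcShi {ℓ k n : ℕ} {F : Polynomial (R ℓ)}
    (h : F.comp (Polynomial.X + Polynomial.C (MvPolynomial.X (Fin.last ℓ))) - F =
      Polynomial.C (MvPolynomial.X (Fin.last ℓ)) * shiIntegrand ℓ k n) :
    evalVars F ∈ DcShi ℓ (k + 1) := by
  refine ⟨by simp [evalVars], fun i j hij p hp1 hp2 => ?_⟩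
  simp only [evalVars, Fin.snoc_castSucc, Fin.snoc_last, mul_zero, sub_zero]
  push_cast at hp1 hp2
  rcases lt_or_ge p 0 with hp | hp
  · obtain ⟨s, rfl⟩ : ∃ s : ℕ, p = -(s : ℤ) := ⟨p.natAbs, by omega⟩
    have h1 := eval_shiftedVar_eq_of_forall h i s
      fun t ht => eval_shiIntegrand_shiftedVar_eq_zero (by omega) i
    have h2 := Polynomial.sub_dvd_eval_sub (shiftedVar i s) (MvPolynomial.X j.castSucc) F
    rw [h1] at h2
    refine dvd_trans (dvd_of_eq ?_) h2
    simp [shiftedVar]; ring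
  · obtain ⟨s, rfl⟩ : ∃ s : ℕ, p = s := ⟨p.toNat, by omega⟩
    have h2 := Polynomial.sub_dvd_eval_sub (MvPolynomial.X i.castSucc) (shiftedVar j s) F
    have h3 : (MvPolynomial.X i.castSucc - MvPolynomial.X j.castSucc -
        ((s : ℤ) : R ℓ) * MvPolynomial.X (Fin.last ℓ)) =
        MvPolynomial.X i.castSucc - shiftedVar j s := by
      simp only [shiftedVar]; ring
    rw [h3]
    rcases lt_or_ge s (k + 1) with hs | hs
    · rwa [eval_shiftedVar_eq_of_forall h j s
        fun t ht => eval_shiIntegrand_shiftedVar_eq_zero (by omega) j] at h2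
    · obtain rfl : s = k + 1 := by omega
      have h1 := eval_shiftedVar_eq_of_forall h j k
        fun t ht => eval_shiIntegrand_shiftedVar_eq_zero ht j
      have h4 := eval_shiftedVar_eq h (shiftedVar j k)
      rw [← shiftedVar_add_one, h1] at h4
      have h5 : (MvPolynomial.X i.castSucc - shiftedVar j (k + 1 : ℕ) : R ℓ) ∣
          (shiIntegrand ℓ k n).eval (shiftedVar j k) := by
        rcases lt_or_ge n (j : ℕ) with hj | hj
        · rw [eval_shiIntegrand_shiftedVar_of_lt hj]
          exact dvd_zero _
        · rw [← neg_dvd]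
          refine dvd_trans (dvd_of_eq ?_)
            (sub_shiftedVar_dvd_eval_shiIntegrand (lt_of_lt_of_le hij hj) _)
          simp [shiftedVar]; ring
      rw [show F.eval (MvPolynomial.X i.castSucc) - F.eval (MvPolynomial.X j.castSucc) =
        (F.eval (MvPolynomial.X i.castSucc) - F.eval (shiftedVar j (k + 1 : ℕ))) +
        MvPolynomial.X (Fin.last ℓ) * (shiIntegrand ℓ k n).eval (shiftedVar j k) by
          push_cast; rw [h4]; ring]
      exact dvd_add h2 (h5.mul_left _)

/-- The form `x_i - x_j - p z`, where `q = ((i, j), p)`. -/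
def shiForm {ℓ : ℕ} (q : (Fin ℓ × Fin ℓ) × ℤ) : R ℓ :=
  MvPolynomial.X q.1.1.castSucc - MvPolynomial.X q.1.2.castSucc -
    (q.2 : R ℓ) * MvPolynomial.X (Fin.last ℓ)

/-- The indices of the forms `x_i - x_j - p z` of the extended Shi arrangement. -/
def shiIndex (ℓ m : ℕ) : Finset ((Fin ℓ × Fin ℓ) × ℤ) :=
  (Finset.univ.filter fun q : Fin ℓ × Fin ℓ => q.1 < q.2) ×ˢ Finset.Icc (1 - (m : ℤ)) m

/-- The defining polynomial of the cone over the extended Shi arrangement. -/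
def shiDefiningPoly (ℓ m : ℕ) : R ℓ :=
  MvPolynomial.X (Fin.last ℓ) * ∏ q ∈ shiIndex ℓ m, shiForm q

lemma mem_shiIndex {ℓ m : ℕ} {q : (Fin ℓ × Fin ℓ) × ℤ} :
    q ∈ shiIndex ℓ m ↔ q.1.1 < q.1.2 ∧ 1 - (m : ℤ) ≤ q.2 ∧ q.2 ≤ m := by
  simp [shiIndex]

lemma card_pairs_lt (ℓ : ℕ) :
    (Finset.univ.filter fun q : Fin ℓ × Fin ℓ => q.1 < q.2).card * 2 = ℓ * (ℓ - 1) := by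
  have h : (Finset.univ.filter fun q : Fin ℓ × Fin ℓ => q.1 < q.2).card =
      ∑ j : Fin ℓ, (j : ℕ) := by
    rw [Finset.card_filter, Fintype.sum_prod_type_right]
    refine Finset.sum_congr rfl fun j _ => ?_
    rw [← Finset.card_filter, ← Fin.card_Iio j]
    congr 1
    ext i
    simp
  rw [h, Fin.sum_univ_eq_sum_range (fun j => j), Finset.sum_range_id_mul_two]

lemma card_shiIndex (ℓ m : ℕ) : (shiIndex ℓ m).card = (ℓ - 1) * (m * ℓ) := by
  rw [shiIndex, Finset.card_product, Int.card_Icc,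
    show ((m : ℤ) + 1 - (1 - m)).toNat = 2 * m by omega, ← mul_assoc, card_pairs_lt]
  ring

lemma isHomogeneous_shiForm {ℓ : ℕ} (q : (Fin ℓ × Fin ℓ) × ℤ) : (shiForm q).IsHomogeneous 1 :=
  ((MvPolynomial.isHomogeneous_X _ _).sub (MvPolynomial.isHomogeneous_X _ _)).sub
    (isHomogeneous_int_mul_X _ _ _)

lemma isHomogeneous_shiDefiningPoly (ℓ m : ℕ) :
    (shiDefiningPoly ℓ m).IsHomogeneous (1 + (ℓ - 1) * (m * ℓ)) := by
  refine (MvPolynomial.isHomogeneous_X _ _).mul ?_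
  rw [← card_shiIndex, Finset.card_eq_sum_ones]
  exact MvPolynomial.IsHomogeneous.prod _ _ _ fun q _ => isHomogeneous_shiForm q

lemma exists_eval_shiForm_eq_zero {ℓ : ℕ} {q : (Fin ℓ × Fin ℓ) × ℤ} (hq : q.1.1 < q.1.2) :
    ∃ v : Fin (ℓ + 1) → ℂ, v (Fin.last ℓ) = 1 ∧ MvPolynomial.eval v (shiForm q) = 0 ∧
      ∀ q' : (Fin ℓ × Fin ℓ) × ℤ, q'.1.1 < q'.1.2 → q' ≠ q →
        MvPolynomial.eval v (shiForm q') ≠ 0 := by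
  obtain ⟨⟨i, j⟩, p⟩ := q
  simp only at hq
  let w : Fin ℓ → ℂ := fun n =>
    if n = i then (⟨p, ((j : ℕ) : ℝ)⟩ : ℂ) else ⟨0, ((n : ℕ) : ℝ)⟩
  refine ⟨Fin.snoc (α := fun _ => ℂ) w 1, by simp, ?_, ?_⟩
  · simp only [shiForm, map_sub, map_mul, MvPolynomial.eval_X, Fin.snoc_castSucc, Fin.snoc_last,
      map_intCast, mul_one]
    apply Complex.ext <;> simp [w, hq.ne']
  · rintro ⟨⟨i', j'⟩, p'⟩ hq' hne h
    simp only at hq'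
    simp only [shiForm, map_sub, map_mul, MvPolynomial.eval_X, Fin.snoc_castSucc, Fin.snoc_last,
      map_intCast, mul_one] at h
    have him := congrArg Complex.im h
    have hre := congrArg Complex.re h
    simp only [Complex.sub_im, Complex.sub_re, Complex.intCast_im, Complex.intCast_re,
      Complex.zero_im, Complex.zero_re, sub_zero] at him hre
    have hw : ∀ n, (w n).im = (((if n = i then j else n : Fin ℓ) : ℕ) : ℝ) := by
      intro n
      by_cases hn : n = i <;> simp [w, hn]
    rw [hw, hw, sub_eq_zero, Nat.cast_inj, Fin.val_inj] at him
    by_cases h1 : i' = i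
    · subst h1
      rw [if_pos rfl, if_neg hq'.ne'] at him
      subst him
      simp only [w, if_true, if_neg hq'.ne', sub_zero, sub_eq_zero, Int.cast_inj] at hre
      exact hne (by rw [hre])
    · rw [if_neg h1] at him
      by_cases h2 : j' = i
      · rw [if_pos h2] at him
        subst him h2
        exact absurd hq hq'.not_gt
      · rw [if_neg h2] at him
        exact hq'.ne him

lemma irreducible_of_isHomogeneous_one {σ : Type*} {p : MvPolynomial σ ℂ}
    (hp : p.IsHomogeneous 1) (h0 : p ≠ 0) : Irreducible p := by
  refine MvPolynomial.irreducible_of_totalDegree_eq_one (hp.totalDegree h0) fun x hx => ?_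
  rw [isUnit_iff_ne_zero]
  rintro rfl
  refine h0 (MvPolynomial.ext _ _ fun i => ?_)
  rw [zero_dvd_iff.1 (hx i), MvPolynomial.coeff_zero]

lemma shiForm_ne_zero {ℓ : ℕ} {q : (Fin ℓ × Fin ℓ) × ℤ} (hq : q.1.1 < q.1.2) :
    shiForm q ≠ 0 := by
  obtain ⟨v, -, -, hv⟩ := exists_eval_shiForm_eq_zero (q := (q.1, q.2 + 1)) hq
  intro h
  refine hv q hq (fun e => ?_) (by rw [h, map_zero])
  have := congrArg Prod.snd e
  simp at this

lemma isRelPrime_of_eval {σ : Type*} {p q : MvPolynomial σ ℂ} (hp : Irreducible p) (v : σ → ℂ)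
    (h0 : MvPolynomial.eval v p = 0) (h1 : MvPolynomial.eval v q ≠ 0) : IsRelPrime p q := by
  rw [hp.isRelPrime_iff_not_dvd]
  intro h
  have := map_dvd (MvPolynomial.eval v) h
  rw [h0, zero_dvd_iff] at this
  exact h1 this

lemma irreducible_shiForm {ℓ : ℕ} {q : (Fin ℓ × Fin ℓ) × ℤ} (hq : q.1.1 < q.1.2) :
    Irreducible (shiForm q) :=
  irreducible_of_isHomogeneous_one (isHomogeneous_shiForm q) (shiForm_ne_zero hq)

lemma shiDefiningPoly_dvd {ℓ m : ℕ} {r : R ℓ} (hz : MvPolynomial.X (Fin.last ℓ) ∣ r)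
    (h : ∀ q ∈ shiIndex ℓ m, shiForm q ∣ r) : shiDefiningPoly ℓ m ∣ r := by
  refine IsRelPrime.mul_dvd ?_ hz (Finset.prod_dvd_of_isRelPrime ?_ h)
  · refine IsRelPrime.prod_right fun q hq => IsRelPrime.symm ?_
    obtain ⟨v, hv1, hv0, -⟩ := exists_eval_shiForm_eq_zero (mem_shiIndex.1 hq).1
    exact isRelPrime_of_eval (irreducible_shiForm (mem_shiIndex.1 hq).1) v hv0 (by simp [hv1])
  · intro q hq q' hq' hne
    have hq := (mem_shiIndex.1 hq).1
    obtain ⟨v, -, hv0, hv⟩ := exists_eval_shiForm_eq_zero hq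
    exact isRelPrime_of_eval (irreducible_shiForm hq) v hv0
      (hv q' (mem_shiIndex.1 hq').1 hne.symm)

lemma dvd_det_of_dvd_mulVec {n A : Type*} [Fintype n] [DecidableEq n] [CommRing A]
    {M : Matrix n n A} {w : n → A} {α : A} (h : ∀ a, α ∣ (M.mulVec w) a) {i : n} (hi : w i = 1) :
    α ∣ M.det := by
  have h1 : M.adjugate.mulVec (M.mulVec w) = M.det • w := by
    rw [Matrix.mulVec_mulVec, Matrix.adjugate_mul, Matrix.smul_mulVec, Matrix.one_mulVec]
  have h2 := congrFun h1 i
  rw [Pi.smul_apply, hi, smul_eq_mul, mul_one] at h2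
  rw [← h2]
  exact Finset.dvd_sum fun j _ => (h j).mul_left _

lemma shiDefiningPoly_dvd_det {ℓ m : ℕ} {M : Matrix (Fin (ℓ + 1)) (Fin (ℓ + 1)) (R ℓ)}
    (hM : ∀ a, M a ∈ DcShi ℓ m) : shiDefiningPoly ℓ m ∣ M.det := by
  refine shiDefiningPoly_dvd ?_ ?_
  · refine dvd_det_of_dvd_mulVec (w := Pi.single (Fin.last ℓ) 1) (fun a => ?_)
      (Pi.single_eq_same _ _)
    rw [Matrix.mulVec_single_one]
    exact (hM a).1
  · rintro ⟨⟨i, j⟩, p⟩ hq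
    obtain ⟨hij, hp1, hp2⟩ := mem_shiIndex.1 hq
    have hne : i.castSucc ≠ j.castSucc := fun e => hij.ne (Fin.castSucc_injective _ e)
    refine dvd_det_of_dvd_mulVec (w := Pi.single i.castSucc 1 - Pi.single j.castSucc 1 -
      Pi.single (Fin.last ℓ) (p : R ℓ)) (i := i.castSucc) (fun a => ?_)
      (by simp [hne, (Fin.castSucc_lt_last i).ne])
    have : (M.mulVec (Pi.single i.castSucc 1 - Pi.single j.castSucc 1 -
        Pi.single (Fin.last ℓ) (p : R ℓ))) a =
        M a i.castSucc - M a j.castSucc - (p : R ℓ) * M a (Fin.last ℓ) := by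
      rw [Matrix.mulVec_sub, Matrix.mulVec_sub]
      simp [Matrix.mulVec_single, mul_comm]
    rw [this]
    exact (hM a).2 i j hij p hp1 hp2

lemma isHomogeneous_det {σ n : Type*} [Fintype n] [DecidableEq n]
    {M : Matrix n n (MvPolynomial σ ℂ)} {d : n → ℕ} (h : ∀ a i, (M a i).IsHomogeneous (d a)) :
    M.det.IsHomogeneous (∑ a, d a) := by
  rw [← Matrix.det_transpose, Matrix.det_apply]
  refine MvPolynomial.IsHomogeneous.sum _ _ _ fun s _ => ?_
  have h1 : (∏ i, M.transpose (s i) i).IsHomogeneous (∑ a, d a) :=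
    MvPolynomial.IsHomogeneous.prod _ _ _ fun i _ => h i (s i)
  rcases Int.units_eq_one_or (Equiv.Perm.sign s) with hs | hs
  · rwa [hs, one_smul]
  · rw [hs, Units.neg_smul, one_smul]
    exact h1.neg

/-- Saito's criterion for the cone over the extended Shi arrangement. -/
theorem mem_span_of_mem_DcShi {ℓ m : ℕ} {b : Fin (ℓ + 1) → Fin (ℓ + 1) → R ℓ}
    (hb : ∀ a, b a ∈ DcShi ℓ m) {d : Fin (ℓ + 1) → ℕ} (hd : ∀ a i, (b a i).IsHomogeneous (d a))
    (hsum : ∑ a, d a = 1 + (ℓ - 1) * (m * ℓ)) (hli : LinearIndependent (R ℓ) b)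
    {v : Fin (ℓ + 1) → R ℓ} (hv : v ∈ DcShi ℓ m) : v ∈ Submodule.span (R ℓ) (Set.range b) := by
  set M : Matrix (Fin (ℓ + 1)) (Fin (ℓ + 1)) (R ℓ) := Matrix.of b with hM
  have hdet : M.det ≠ 0 := by
    intro h0
    obtain ⟨c, hc0, hc⟩ := Matrix.exists_vecMul_eq_zero_iff.2 h0
    rw [Fintype.linearIndependent_iff] at hli
    refine hc0 (funext (hli c ?_))
    rw [Matrix.vecMul_eq_sum] at hc
    exact hc
  obtain ⟨c, hc⟩ := shiDefiningPoly_dvd_det (M := M) hb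
  have hc0 : c ≠ 0 := by rintro rfl; exact hdet (by rw [hc, mul_zero])
  have hQ0 : shiDefiningPoly ℓ m ≠ 0 := fun h => hdet (by rw [hc, h, zero_mul])
  have hdeg := (isHomogeneous_det (M := M) hd).totalDegree hdet
  rw [hsum, hc, MvPolynomial.totalDegree_mul_of_isDomain hQ0 hc0,
    (isHomogeneous_shiDefiningPoly ℓ m).totalDegree hQ0, Nat.add_eq_left,
    MvPolynomial.totalDegree_eq_zero_iff_eq_C] at hdeg
  have hu : IsUnit c := by
    rw [hdeg]
    refine IsUnit.map MvPolynomial.C (isUnit_iff_ne_zero.2 fun h => hc0 ?_)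
    rw [hdeg, h, map_zero]
  obtain ⟨u, rfl⟩ := hu
  have hcr : ∀ a, ∃ e, M.transpose.cramer v a = shiDefiningPoly ℓ m * e := by
    intro a
    rw [Matrix.cramer_transpose_apply]
    refine shiDefiningPoly_dvd_det fun a' => ?_
    rcases eq_or_ne a' a with rfl | h
    · rwa [Matrix.updateRow_self]
    · rw [Matrix.updateRow_ne h]
      exact hb a'
  choose e he using hcr
  have h1 := Matrix.mulVec_cramer M.transpose v
  rw [Matrix.det_transpose, Matrix.mulVec_transpose, Matrix.vecMul_eq_sum] at h1
  have h2 : v = ∑ a, ((↑u⁻¹ : R ℓ) * e a) • b a := by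
    have h3 : M.det • v = M.det • ∑ a, ((↑u⁻¹ : R ℓ) * e a) • b a := by
      rw [← h1, Finset.smul_sum]
      refine Finset.sum_congr rfl fun a _ => ?_
      rw [he, smul_smul, hc, show shiDefiningPoly ℓ m * ↑u * (↑u⁻¹ * e a) =
        shiDefiningPoly ℓ m * (↑u * ↑u⁻¹) * e a by ring, Units.mul_inv, mul_one]
      rfl
    exact smul_right_injective _ hdet h3
  rw [h2]
  exact sum_mem fun a _ => Submodule.smul_mem _ _ (Submodule.subset_span ⟨a, rfl⟩)

lemma injective_shiftedVar_option {ℓ k : ℕ} (i₀ : Fin ℓ) :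
    Function.Injective fun o : Option (Fin ℓ × Fin (k + 1)) =>
      o.elim (shiftedVar i₀ (-1)) fun q => shiftedVar q.1 ((q.2 : ℕ) : ℤ) := by
  rintro (_ | ⟨i, s⟩) (_ | ⟨j, t⟩) h
  · rfl
  · have := (shiftedVar_inj h).2
    omega
  · have := (shiftedVar_inj h).2
    omega
  · obtain ⟨rfl, hst⟩ := shiftedVar_inj h
    rw [Nat.cast_inj, Fin.val_inj] at hst
    exact congrArg some (Prod.ext rfl hst)

/-- The discrete integrals of the integrands with `n ≠ 0` are independent modulo constants, even
after evaluation at `x_1, …, x_ℓ`. -/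
lemma eq_zero_of_sum_eval_eq_zero {ℓ k : ℕ} (hℓ : 0 < ℓ) {F : Fin ℓ → Polynomial (R ℓ)}
    (hF : ∀ n, F n ∈ jointlyHomogeneous ℓ ((k + 1) * ℓ))
    (hd : ∀ n : Fin ℓ, (F n).comp
      (Polynomial.X + Polynomial.C (MvPolynomial.X (Fin.last ℓ))) - F n =
        Polynomial.C (MvPolynomial.X (Fin.last ℓ)) * shiIntegrand ℓ k n)
    {c₀ : R ℓ} {c : Fin ℓ → R ℓ} (hc : c ⟨0, hℓ⟩ = 0)
    (h : ∀ i : Fin ℓ, c₀ + ∑ n, c n * (F n).eval (MvPolynomial.X i.castSucc) = 0) :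
    c₀ = 0 ∧ c = 0 := by
  set P : Polynomial (R ℓ) := Polynomial.C c₀ + ∑ n, Polynomial.C (c n) * F n with hP
  set G : Polynomial (R ℓ) := ∑ n : Fin ℓ, Polynomial.C (c n) * shiIntegrand ℓ k n with hG
  have hPd : P.comp (Polynomial.X + Polynomial.C (MvPolynomial.X (Fin.last ℓ))) - P =
      Polynomial.C (MvPolynomial.X (Fin.last ℓ)) * G := by
    have : ∑ n : Fin ℓ, Polynomial.C (c n) * ((F n).comp
        (Polynomial.X + Polynomial.C (MvPolynomial.X (Fin.last ℓ))) - F n) =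
        Polynomial.C (MvPolynomial.X (Fin.last ℓ)) * G := by
      rw [hG, Finset.mul_sum]
      refine Finset.sum_congr rfl fun n _ => ?_
      rw [hd]
      ring
    rw [← this, hP]
    simp only [mul_sub, Finset.sum_sub_distrib, Polynomial.add_comp, Polynomial.sum_comp,
      Polynomial.mul_comp, Polynomial.C_comp]
    ring
  have hGe : ∀ r, G.eval r = ∑ n : Fin ℓ, c n * (shiIntegrand ℓ k n).eval r := by
    intro r
    simp [hG, Polynomial.eval_finsetSum]
  have hroot : ∀ (i : Fin ℓ) (s : ℕ), s < k + 1 → P.eval (shiftedVar i s) = 0 := by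
    intro i s hs
    rw [eval_shiftedVar_eq_of_forall hPd i s]
    · rw [← h i]
      simp [hP, Polynomial.eval_finsetSum]
    · intro t ht
      rw [hGe]
      refine Finset.sum_eq_zero fun n _ => ?_
      rw [eval_shiIntegrand_shiftedVar_eq_zero (by omega), mul_zero]
  have hvanish : ∀ i n : Fin ℓ, i < n →
      (shiIntegrand ℓ k n).eval (shiftedVar i (-1)) = 0 := by
    intro i n hin
    have := sub_shiftedVar_dvd_eval_shiIntegrand (k := k) hin (shiftedVar i (-1))
    rwa [sub_self, zero_dvd_iff] at this
  have hP0 : P = 0 := by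
    refine Polynomial.eq_zero_of_natDegree_lt_card_of_eval_eq_zero P
      (injective_shiftedVar_option (k := k) ⟨0, hℓ⟩) ?_ ?_
    · rintro (_ | ⟨i, s⟩)
      · have h1 := eval_shiftedVar_eq hPd (shiftedVar ⟨0, hℓ⟩ (-1))
        have h0 := hroot ⟨0, hℓ⟩ 0 (Nat.succ_pos k)
        rw [Nat.cast_zero] at h0
        rw [← shiftedVar_add_one, neg_add_cancel, h0, hGe, Finset.sum_eq_zero, mul_zero, add_zero] at h1
        · exact h1.symm
        · intro n _
          rcases eq_or_ne n ⟨0, hℓ⟩ with rfl | hn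
          · rw [hc, zero_mul]
          · rw [hvanish, mul_zero]
            exact Fin.lt_def.2 (Nat.pos_of_ne_zero fun e => hn (Fin.ext e))
      · exact hroot i s s.2
    · rw [Fintype.card_option, Fintype.card_prod, Fintype.card_fin, Fintype.card_fin,
        Nat.lt_succ_iff, mul_comm]
      refine Polynomial.natDegree_add_le_of_degree_le (by simp)
        (Polynomial.natDegree_sum_le_of_forall_le _ _ fun n _ => ?_)
      exact (Polynomial.natDegree_C_mul_le _ _).trans
        (natDegree_le_of_mem_jointlyHomogeneous (hF n))
  have hG0 : G = 0 := by
    rw [hP0, Polynomial.zero_comp, sub_zero, eq_comm, mul_eq_zero, Polynomial.C_eq_zero] at hPd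
    exact hPd.resolve_left (MvPolynomial.X_ne_zero _)
  have hc0 : ∀ n, c n = 0 := by
    intro n
    induction n using WellFoundedLT.induction with
    | _ n ih =>
      have h1 := hGe (shiftedVar n (-1))
      rw [hG0, Polynomial.eval_zero, Finset.sum_eq_single n] at h1
      · exact (mul_eq_zero.1 h1.symm).resolve_right (eval_shiIntegrand_ne_zero n)
      · intro n' _ hne
        rcases lt_or_gt_of_ne hne with hlt | hlt
        · rw [ih n' hlt, zero_mul]
        · rw [hvanish n n' hlt, mul_zero]
      · simp
  refine ⟨?_, funext hc0⟩
  simpa [hc0] using h ⟨0, hℓ⟩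

/-- The constant derivation `∂_1 + ⋯ + ∂_ℓ`. -/
def constDerivation (ℓ : ℕ) : Fin (ℓ + 1) → R ℓ :=
  Fin.snoc (α := fun _ => R ℓ) (fun _ => 1) 0

lemma constDerivation_mem_DcShi (ℓ m : ℕ) : constDerivation ℓ ∈ DcShi ℓ m :=
  ⟨by simp [constDerivation], fun i j _ p _ _ => by simp [constDerivation]⟩

lemma X_mem_DcShi (ℓ m : ℕ) : (fun i => MvPolynomial.X i) ∈ DcShi ℓ m :=
  ⟨dvd_rfl, fun _ _ _ _ _ _ => dvd_rfl⟩

/-- The homogeneous basis built from discrete integrals `F`; the entry `F 0` is not used. -/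
def shiBasis {ℓ : ℕ} (F : Fin ℓ → Polynomial (R ℓ)) : Fin (ℓ + 1) → Fin (ℓ + 1) → R ℓ :=
  Fin.cons (α := fun _ => Fin (ℓ + 1) → R ℓ) (constDerivation ℓ) fun n =>
    if (n : ℕ) = 0 then fun i => MvPolynomial.X i else evalVars (F n)

lemma linearIndependent_shiBasis {ℓ k : ℕ} (hℓ : 0 < ℓ) {F : Fin ℓ → Polynomial (R ℓ)}
    (hF : ∀ n, F n ∈ jointlyHomogeneous ℓ ((k + 1) * ℓ))
    (hd : ∀ n : Fin ℓ, (F n).comp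
      (Polynomial.X + Polynomial.C (MvPolynomial.X (Fin.last ℓ))) - F n =
        Polynomial.C (MvPolynomial.X (Fin.last ℓ)) * shiIntegrand ℓ k n) :
    LinearIndependent (R ℓ) (shiBasis F) := by
  rw [Fintype.linearIndependent_iff]
  intro g hg
  rw [Fin.sum_univ_succ] at hg
  simp only [shiBasis, Fin.cons_zero, Fin.cons_succ] at hg
  have hlast := congrFun hg (Fin.last ℓ)
  simp only [Pi.add_apply, Pi.smul_apply, Finset.sum_apply, constDerivation, Fin.snoc_last,
    Pi.zero_apply, smul_eq_mul] at hlast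
  rw [Finset.sum_eq_single (⟨0, hℓ⟩ : Fin ℓ)] at hlast
  rotate_left
  · intro n _ hn
    rw [if_neg fun e => hn (Fin.ext e)]
    simp [evalVars]
  · simp
  rw [if_pos rfl, mul_zero, zero_add, mul_eq_zero, or_iff_left (MvPolynomial.X_ne_zero _)] at hlast
  have key := eq_zero_of_sum_eval_eq_zero hℓ hF hd (c₀ := g 0) (c := fun n => g n.succ) hlast ?_
  · intro a
    refine Fin.cases key.1 (fun n => ?_) a
    exact congrFun key.2 n
  · intro i
    have hi := congrFun hg i.castSucc
    simp only [Pi.add_apply, Pi.smul_apply, Finset.sum_apply, constDerivation, Fin.snoc_castSucc,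
      Pi.zero_apply, smul_eq_mul, mul_one] at hi
    rw [← hi]
    congr 1
    refine Finset.sum_congr rfl fun n _ => ?_
    by_cases hn : (n : ℕ) = 0
    · rw [show n = ⟨0, hℓ⟩ from Fin.ext hn, hlast, zero_mul, zero_mul]
    · rw [if_neg hn]
      simp [evalVars]

theorem stmt17 (ℓ m : ℕ) (hℓ : 2 ≤ ℓ) (hm : 1 ≤ m) :
    ∃ b : Fin (ℓ + 1) → (Fin (ℓ + 1) → R ℓ),
      (∀ a : Fin (ℓ + 1),
        b a ∈ DcShi ℓ m ∧
        ∀ i : Fin (ℓ + 1),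
          (b a i).IsHomogeneous
            (if (a : ℕ) = 0 then 0 else if (a : ℕ) = 1 then 1 else m * ℓ)) ∧
      LinearIndependent (R ℓ) b ∧
      (∀ v ∈ DcShi ℓ m, v ∈ Submodule.span (R ℓ) (Set.range b)) := by
  obtain ⟨k, rfl⟩ : ∃ k, m = k + 1 := ⟨m - 1, by omega⟩
  have hdeg : (k + 1) * ℓ - 1 + 1 = (k + 1) * ℓ :=
    Nat.sub_add_cancel (Nat.mul_pos k.succ_pos (by omega))
  have hex : ∀ n : Fin ℓ, ∃ F ∈ jointlyHomogeneous ℓ ((k + 1) * ℓ),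
      F.comp (Polynomial.X + Polynomial.C (MvPolynomial.X (Fin.last ℓ))) - F =
        Polynomial.C (MvPolynomial.X (Fin.last ℓ)) * shiIntegrand ℓ k n := fun n =>
    hdeg ▸ exists_difference_eq (MvPolynomial.isHomogeneous_X _ _)
      (shiIntegrand_mem_jointlyHomogeneous n.2)
  choose F hF hFd using hex
  have hmem : ∀ a, shiBasis F a ∈ DcShi ℓ (k + 1) := by
    refine Fin.cases ?_ fun n => ?_
    · exact constDerivation_mem_DcShi ℓ _
    · rw [shiBasis, Fin.cons_succ]
      split_ifs
      · exact X_mem_DcShi ℓ _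
      · exact evalVars_mem_DcShi (hFd n)
  have hhom : ∀ a i, (shiBasis F a i).IsHomogeneous
      (if (a : ℕ) = 0 then 0 else if (a : ℕ) = 1 then 1 else (k + 1) * ℓ) := by
    refine Fin.cases (fun i => ?_) fun n i => ?_
    · rw [shiBasis, Fin.cons_zero, if_pos (Fin.val_zero _), constDerivation]
      refine Fin.lastCases ?_ (fun i => ?_) i
      · rw [Fin.snoc_last]
        exact MvPolynomial.isHomogeneous_zero _ _ _
      · rw [Fin.snoc_castSucc]
        exact MvPolynomial.isHomogeneous_one _ _
    · rw [shiBasis, Fin.cons_succ, Fin.val_succ, if_neg (Nat.succ_ne_zero _)]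
      simp only [Nat.add_eq_right]
      split_ifs
      · exact MvPolynomial.isHomogeneous_X _ _
      · rw [evalVars]
        refine Fin.lastCases ?_ (fun i => ?_) i
        · rw [Fin.snoc_last]
          exact MvPolynomial.isHomogeneous_zero _ _ _
        · rw [Fin.snoc_castSucc]
          exact isHomogeneous_eval_of_mem_jointlyHomogeneous (hF n)
            (MvPolynomial.isHomogeneous_X _ _)
  have hli := linearIndependent_shiBasis (by omega) hF hFd
  refine ⟨shiBasis F, fun a => ⟨hmem a, hhom a⟩, hli, fun v hv =>
    mem_span_of_mem_DcShi hmem hhom ?_ hli hv⟩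
  obtain ⟨l, rfl⟩ : ∃ l, ℓ = l + 1 := ⟨ℓ - 1, by omega⟩
  rw [Fin.sum_univ_succ, Fin.sum_univ_succ]
  simp

end
end
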